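/- arXiv:1609.09634 — 2 statements merged into one kernel-verified Lean document; each statement's English description precedes it below -/
import Mathlib

section
/- (Theorem 1, lower bound in (t001).) For any two solutions p*, p** of the forward Kolmogorov system and any 0 ≤ s ≤ t with ‖p*(s) − p**(s)‖_{1D} < ∞, one has ‖p*(t) − p**(t)‖_{1D} ≥ exp(−∫_s^t χ(u) du) · ‖p*(s) − p**(s)‖_{1D}. -/
open MeasureTheory intervalIntegral Filter
open scoped Topology

noncomputable section

/-- `p : ℝ → ℕ → ℝ` is a solution of the forward Kolmogorov system `dp/dt = A(t)p(t)` with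
transposed intensity matrix `a`: each `p t` (for `t ≥ 0`) is a stochastic vector, and the
integral form `p_i(t) = p_i(s) + ∫_s^t Σ_j a_{ij}(u) p_j(u) du` of the equations holds for
all `i ≥ 0` and `0 ≤ s ≤ t`. -/
def IsKolmogorovSolution (a : ℕ → ℕ → ℝ → ℝ) (p : ℝ → ℕ → ℝ) : Prop :=
  (∀ t : ℝ, 0 ≤ t → (∀ i, 0 ≤ p t i) ∧ HasSum (p t) 1) ∧
  (∀ i : ℕ, ∀ s t : ℝ, 0 ≤ s → s ≤ t →
    p t i = p s i + ∫ u in s..t, ∑' j : ℕ, a i j u * p u j)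

/-- The weighted norm `‖w‖_{1D} = Σ_{k≥1} d_k |Σ_{i≥k} w_i|` (the coordinate `w 0` is not
used, and `d k` only matters for `k ≥ 1`). -/
def norm1D (d : ℕ → ℝ) (w : ℕ → ℝ) : ℝ :=
  ∑' k : ℕ, d (k + 1) * |∑' i : ℕ, w (k + 1 + i)|

/-- Summability of the series defining `‖w‖_{1D}`, i.e. `‖w‖_{1D} < ∞`. -/
def Norm1DFinite (d : ℕ → ℝ) (w : ℕ → ℝ) : Prop :=
  Summable (fun k : ℕ => d (k + 1) * |∑' i : ℕ, w (k + 1 + i)|)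

/-- Entries `b_{ij}(t) = a_{ij}(t) − a_{i0}(t)` of the reduced matrix `B(t)` (for
`i, j ≥ 1`), with the convention `b_{k,0}(t) := 0`. -/
def bEntry (a : ℕ → ℕ → ℝ → ℝ) (i j : ℕ) (t : ℝ) : ℝ :=
  if j = 0 then 0 else a i j t - a i 0 t

/-- Entries `b*_{ij}(t) = (d_i/d_j) Σ_{k≥i} (b_{kj}(t) − b_{k,j−1}(t))` of `D B(t) D⁻¹`. -/
def bStar (d : ℕ → ℝ) (a : ℕ → ℕ → ℝ → ℝ) (i j : ℕ) (t : ℝ) : ℝ :=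
  (d i / d j) * ∑' k : ℕ, (bEntry a (i + k) j t - bEntry a (i + k) (j - 1) t)

/-- `α_i(t) = −Σ_{j≥1} b*_{ji}(t)`. -/
def alphaI (d : ℕ → ℝ) (a : ℕ → ℕ → ℝ → ℝ) (i : ℕ) (t : ℝ) : ℝ :=
  -∑' j : ℕ, bStar d a (j + 1) i t

/-- `α(t) = inf_{i≥1} α_i(t)`. -/
def alphaInf (d : ℕ → ℝ) (a : ℕ → ℕ → ℝ → ℝ) (t : ℝ) : ℝ :=
  ⨅ i : ℕ, alphaI d a (i + 1) t

/-- `χ(t) = sup_{i≥1} Σ_{j≥1} |b*_{ji}(t)|`. -/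
def chiSup (d : ℕ → ℝ) (a : ℕ → ℕ → ℝ → ℝ) (t : ℝ) : ℝ :=
  ⨆ i : ℕ, ∑' j : ℕ, |bStar d a (j + 1) (i + 1) t|


lemma ac_exp {f : ℝ → ℝ} {a b : ℝ} (hf : AbsolutelyContinuousOnInterval f a b) :
    AbsolutelyContinuousOnInterval (fun x => Real.exp (f x)) a b := by
  obtain ⟨C, hC⟩ := hf.exists_bound
  have hlip : ∀ x ∈ Set.uIcc a b, ∀ y ∈ Set.uIcc a b,
      dist (Real.exp (f x)) (Real.exp (f y)) ≤ Real.exp C * dist (f x) (f y) := by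
    intro x hx y hy
    have := (convex_Iic C).norm_image_sub_le_of_norm_hasDerivWithin_le (f := Real.exp)
      (f' := Real.exp) (C := Real.exp C) (x := f y) (y := f x)
      (fun z _ => (Real.hasDerivAt_exp z).hasDerivWithinAt)
      (fun z hz => by
        rw [Real.norm_eq_abs, abs_of_pos (Real.exp_pos z)]
        exact Real.exp_le_exp.2 hz)
      (le_trans (le_abs_self _) (hC y hy)) (le_trans (le_abs_self _) (hC x hx))
    simpa [dist_eq_norm] using this
  rw [absolutelyContinuousOnInterval_iff] at hf ⊢
  intro ε hε
  obtain ⟨δ, hδ, h⟩ := hf (ε / Real.exp C) (by positivity)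
  refine ⟨δ, hδ, fun E hE hE2 => ?_⟩
  have h1 := h E hE hE2
  have hm : ∀ i ∈ Finset.range E.1, (E.2 i).1 ∈ Set.uIcc a b ∧ (E.2 i).2 ∈ Set.uIcc a b := by
    intro i hi
    exact hE.1 i hi
  calc _ ≤ ∑ i ∈ Finset.range E.1, Real.exp C * dist (f (E.2 i).1) (f (E.2 i).2) :=
        Finset.sum_le_sum fun i hi => hlip _ (hm i hi).1 _ (hm i hi).2
    _ = Real.exp C * ∑ i ∈ Finset.range E.1, dist (f (E.2 i).1) (f (E.2 i).2) := by
        rw [Finset.mul_sum]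
    _ < Real.exp C * (ε / Real.exp C) := by
        exact mul_lt_mul_of_pos_left h1 (Real.exp_pos C)
    _ = ε := by field_simp

lemma integral_mul_exp {κ : ℝ → ℝ} {s u : ℝ} (hκ : IntervalIntegrable κ volume s u) :
    ∫ v in s..u, κ v * Real.exp (∫ r in s..v, κ r) = Real.exp (∫ r in s..u, κ r) - 1 := by
  have hac := hκ.absolutelyContinuousOnInterval_intervalIntegral (c := s) (by simp)
  have h := (ac_exp hac).integral_deriv_eq_sub
  simp only [integral_same, Real.exp_zero] at h
  rw [← h]
  apply intervalIntegral.integral_congr_ae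
  filter_upwards [hκ.ae_hasDerivAt_integral] with x hx hxm
  have := (hx (Set.uIoc_subset_uIcc hxm) s (by simp)).exp
  rw [this.deriv, mul_comm]

lemma gronwall_back {κ F : ℝ → ℝ} {s t : ℝ} (hst : s ≤ t)
    (hκ : IntervalIntegrable κ volume s t) (hκ0 : ∀ v, 0 ≤ κ v)
    (hF : IntervalIntegrable (fun v => κ v * F v) volume s t)
    (h : ∀ v ∈ Set.Icc s t, F v ≤ F t + ∫ r in v..t, κ r * F r) :
    F s ≤ F t * Real.exp (∫ r in s..t, κ r) := by
  have hac := ac_exp (hκ.absolutelyContinuousOnInterval_intervalIntegral (c := s) (by simp))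
  have hac2 := hF.absolutelyContinuousOnInterval_intervalIntegral (c := t) (by simp)
  have hc : AbsolutelyContinuousOnInterval (fun _ : ℝ => F t) s t :=
    (LipschitzOnWith.absolutelyContinuousOnInterval (K := 0)
      (LipschitzWith.const (F t)).lipschitzOnWith)
  have hg := (hc.sub hac2).mul hac
  have hI := hg.integral_deriv_eq_sub
  have hnn : 0 ≤ ∫ v in s..t, deriv (((fun _ : ℝ => F t) - fun x => ∫ r in t..x, κ r * F r) *
      fun x => Real.exp (∫ r in s..x, κ r)) v := by
    apply intervalIntegral.integral_nonneg_of_ae_restrict hst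
    rw [EventuallyLE, ae_restrict_iff' measurableSet_Icc]
    filter_upwards [hκ.ae_hasDerivAt_integral, hF.ae_hasDerivAt_integral] with x h1 h2 hx
    have hx' : x ∈ Set.uIcc s t := by rwa [Set.uIcc_of_le hst]
    have d1 := (h1 hx' s (by simp)).exp
    have d2 := (h2 hx' t (by simp))
    have d3 := ((hasDerivAt_const x (F t)).sub d2).mul d1
    rw [d3.deriv]
    have := h x hx
    rw [intervalIntegral.integral_symm] at this
    have e := Real.exp_pos (∫ r in s..x, κ r)
    have k := hκ0 x
    simp only [Pi.zero_apply, Pi.sub_apply]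
    have : 0 ≤ (Real.exp (∫ r in s..x, κ r) * κ x) * (F t - (∫ r in t..x, κ r * F r) - F x) := by
      apply mul_nonneg (by positivity); linarith
    linarith
  rw [hI] at hnn
  simp at hnn
  have := h s ⟨le_rfl, hst⟩
  rw [intervalIntegral.integral_symm] at this
  linarith

lemma lintegral_mul_exp {κ : ℝ → ℝ} {s u : ℝ} (hsu : s ≤ u)
    (hκ : IntervalIntegrable κ volume s u) (hκ0 : ∀ v, 0 ≤ κ v) :
    ∫⁻ v in Set.Ioc s u, ENNReal.ofReal (κ v) * ENNReal.ofReal (Real.exp (∫ r in s..v, κ r))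
      = ENNReal.ofReal (Real.exp (∫ r in s..u, κ r) - 1) := by
  rw [← integral_mul_exp hκ, intervalIntegral.integral_of_le hsu,
    ofReal_integral_eq_lintegral_ofReal]
  · refine lintegral_congr fun v => ?_
    rw [ENNReal.ofReal_mul (hκ0 v)]
  · have hac := ac_exp (hκ.absolutelyContinuousOnInterval_intervalIntegral (c := s) (by simp))
    exact (hκ.mul_continuousOn hac.continuousOn).1
  · exact Eventually.of_forall fun v => mul_nonneg (hκ0 v) (Real.exp_pos _).le

/-- Picard iterates for the comparison argument. -/
def picardIt (γ : ℕ → ℕ → ℝ → ENNReal) (q0 : ℕ → ENNReal) (s : ℝ) : ℕ → ℕ → ℝ → ENNReal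
  | 0 => fun _ _ => 0
  | n + 1 => fun k u => q0 k + ∫⁻ v in Set.Ioc s u, ∑' j, γ k j v * picardIt γ q0 s n j v

lemma picardIt_measurable (γ : ℕ → ℕ → ℝ → ENNReal) (q0 : ℕ → ENNReal) (s : ℝ) (n k : ℕ) :
    Measurable (picardIt γ q0 s n k) := by
  cases n with
  | zero => exact measurable_const
  | succ n =>
    apply Monotone.measurable
    intro u v huv
    simp only [picardIt]
    gcongr

section core
variable {γ : ℕ → ℕ → ℝ → ENNReal} {Q : ℕ → ℝ → ENNReal} {w : ℕ → ENNReal} {κ : ℝ → ℝ}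
  {s t : ℝ}

lemma sum_lintegral_le {G : ℕ → ℝ → ENNReal} {v u : ℝ} (hv : s ≤ v) (hu : u ≤ t)
    (hγ : ∀ k j, AEMeasurable (γ k j) (volume.restrict (Set.Ioc s t)))
    (hG : ∀ k, AEMeasurable (G k) (volume.restrict (Set.Ioc s t)))
    (hcol : ∀ᵐ r ∂(volume.restrict (Set.Ioc s t)), ∀ j,
      ∑' k, w k * γ k j r ≤ ENNReal.ofReal (κ r) * w j) :
    ∑' k, w k * ∫⁻ r in Set.Ioc v u, ∑' j, γ k j r * G j r ≤
      ∫⁻ r in Set.Ioc v u, ENNReal.ofReal (κ r) * ∑' j, w j * G j r := by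
  have hle : volume.restrict (Set.Ioc v u) ≤ volume.restrict (Set.Ioc s t) :=
    Measure.restrict_mono (Set.Ioc_subset_Ioc hv hu) le_rfl
  have hm : ∀ k, AEMeasurable (fun r => ∑' j, γ k j r * G j r)
      (volume.restrict (Set.Ioc v u)) := fun k =>
    AEMeasurable.tsum fun j => ((hγ k j).mul (hG j)).mono_measure hle
  have : ∀ k, w k * ∫⁻ r in Set.Ioc v u, ∑' j, γ k j r * G j r =
      ∫⁻ r in Set.Ioc v u, w k * ∑' j, γ k j r * G j r := fun k =>
    (lintegral_const_mul'' _ (hm k)).symm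
  simp_rw [this]
  rw [← lintegral_tsum fun k => (hm k).const_mul _]
  apply lintegral_mono_ae
  filter_upwards [ae_mono hle hcol] with r hr
  simp_rw [← ENNReal.tsum_mul_left]
  rw [ENNReal.tsum_comm]
  refine ENNReal.tsum_le_tsum fun j => ?_
  calc _ = (∑' k, w k * γ k j r) * G j r := by
        rw [← ENNReal.tsum_mul_right]; simp_rw [mul_assoc]
    _ ≤ _ := by
        rw [← mul_assoc]; gcongr; exact hr j

lemma core_bound {K : ℝ} (hK : 0 ≤ K) (hw : ∀ k, w k ≠ ⊤)
    (hγ : ∀ k j, AEMeasurable (γ k j) (volume.restrict (Set.Ioc s t)))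
    (hrow : ∀ᵐ r ∂(volume.restrict (Set.Ioc s t)), ∀ k, ∑' j, γ k j r ≤ ENNReal.ofReal K)
    (hcol : ∀ᵐ r ∂(volume.restrict (Set.Ioc s t)), ∀ j,
      ∑' k, w k * γ k j r ≤ ENNReal.ofReal (κ r) * w j)
    (hκ : IntervalIntegrable κ volume s t) (hκ0 : ∀ v, 0 ≤ κ v)
    (hQ1 : ∀ k, ∀ u ∈ Set.Icc s t, Q k u ≤ 1)
    (hQle : ∀ k, ∀ u ∈ Set.Icc s t,
      Q k u ≤ Q k s + ∫⁻ r in Set.Ioc s u, ∑' j, γ k j r * Q j r)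
    (u : ℝ) (hu : u ∈ Set.Icc s t) :
    ∑' k, w k * Q k u ≤ (∑' k, w k * Q k s) * ENNReal.ofReal (Real.exp (∫ r in s..u, κ r)) := by
  have hle : ∀ u ∈ Set.Icc s t,
      volume.restrict (Set.Ioc s u) ≤ volume.restrict (Set.Ioc s t) := fun u hu =>
    Measure.restrict_mono (Set.Ioc_subset_Ioc le_rfl hu.2) le_rfl
  have hκu : ∀ u ∈ Set.Icc s t, IntervalIntegrable κ volume s u := fun u hu =>
    hκ.mono_set (by
      rw [Set.uIcc_of_le hu.1, Set.uIcc_of_le (hu.1.trans hu.2)]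
      exact Set.Icc_subset_Icc le_rfl hu.2)
  set M := ∑' k, w k * Q k s with hM
  set E := picardIt γ (fun k => Q k s) s with hE
  -- weighted bound on the iterates
  have hEb : ∀ n, ∀ u ∈ Set.Icc s t,
      ∑' k, w k * E n k u ≤ M * ENNReal.ofReal (Real.exp (∫ r in s..u, κ r)) := by
    intro n
    induction n with
    | zero => intro u _; simp [hE, picardIt]
    | succ n ih =>
      intro u hu
      have h1 : ∀ k, w k * E (n + 1) k u = w k * Q k s +
          w k * ∫⁻ v in Set.Ioc s u, ∑' j, γ k j v * E n j v := fun k => by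
        simp only [hE, picardIt, mul_add]
      simp_rw [h1]
      rw [ENNReal.tsum_add]
      have h2 : ∑' k, w k * ∫⁻ v in Set.Ioc s u, ∑' j, γ k j v * E n j v ≤
          M * ENNReal.ofReal (Real.exp (∫ r in s..u, κ r) - 1) := by
        refine (sum_lintegral_le le_rfl hu.2 hγ
          (fun k => (picardIt_measurable γ _ s n k).aemeasurable) hcol).trans ?_
        rw [← lintegral_mul_exp hu.1 (hκu u hu) hκ0]
        have hmeas : AEMeasurable (fun v => ENNReal.ofReal (κ v) *
            ENNReal.ofReal (Real.exp (∫ r in s..v, κ r))) (volume.restrict (Set.Ioc s u)) := by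
          have hac := ac_exp ((hκu u hu).absolutelyContinuousOnInterval_intervalIntegral
            (c := s) (by simp))
          have hi := ((hκu u hu).mul_continuousOn hac.continuousOn).1
          have := hi.aestronglyMeasurable.aemeasurable.ennreal_ofReal
          refine this.congr (Eventually.of_forall fun v => ?_)
          simp only
          rw [ENNReal.ofReal_mul (hκ0 v)]
        rw [← lintegral_const_mul'' _ hmeas]
        apply setLIntegral_mono_ae' measurableSet_Ioc
        refine Eventually.of_forall fun v hv => ?_
        calc _ ≤ ENNReal.ofReal (κ v) * (M * ENNReal.ofReal (Real.exp (∫ r in s..v, κ r))) := by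
              gcongr; exact ih v ⟨hv.1.le, hv.2.trans hu.2⟩
          _ = _ := by ring
      calc _ ≤ M + M * ENNReal.ofReal (Real.exp (∫ r in s..u, κ r) - 1) := by gcongr
        _ = M * (ENNReal.ofReal 1 + ENNReal.ofReal (Real.exp (∫ r in s..u, κ r) - 1)) := by
            simp [mul_add]
        _ = _ := by
            rw [← ENNReal.ofReal_add zero_le_one]
            · simp
            · have : 0 ≤ ∫ r in s..u, κ r :=
                intervalIntegral.integral_nonneg hu.1 fun x _ => hκ0 x
              linarith [Real.add_one_le_exp (∫ r in s..u, κ r)]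
  -- remainder
  have hR : ∀ n, ∀ k, ∀ u ∈ Set.Icc s t,
      Q k u ≤ E n k u + ENNReal.ofReal ((1 / 2) ^ n * Real.exp (2 * K * (u - s))) := by
    intro n
    induction n with
    | zero =>
      intro k u hu
      refine (hQ1 k u hu).trans ?_
      have : (1 : ENNReal) ≤ ENNReal.ofReal ((1 / 2) ^ 0 * Real.exp (2 * K * (u - s))) := by
        rw [← ENNReal.ofReal_one]
        apply ENNReal.ofReal_le_ofReal
        have : 0 ≤ 2 * K * (u - s) := by have := hu.1; apply mul_nonneg <;> linarith
        simpa using this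
      exact this.trans le_add_self
    | succ n ih =>
      intro k u hu
      refine (hQle k u hu).trans ?_
      have h1 : ∫⁻ r in Set.Ioc s u, ∑' j, γ k j r * Q j r ≤
          ∫⁻ r in Set.Ioc s u, ((∑' j, γ k j r * E n j r) +
            ENNReal.ofReal K * ENNReal.ofReal ((1 / 2) ^ n * Real.exp (2 * K * (r - s)))) := by
        apply lintegral_mono_ae
        filter_upwards [ae_mono (hle u hu) hrow, ae_restrict_mem measurableSet_Ioc] with r hr hrm
        have hr' : r ∈ Set.Icc s t := ⟨hrm.1.le, hrm.2.trans hu.2⟩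
        calc _ ≤ ∑' j, (γ k j r * E n j r +
                γ k j r * ENNReal.ofReal ((1 / 2) ^ n * Real.exp (2 * K * (r - s)))) := by
              refine ENNReal.tsum_le_tsum fun j => ?_
              rw [← mul_add]; gcongr; exact ih j r hr'
          _ ≤ _ := by
              rw [ENNReal.tsum_add, ENNReal.tsum_mul_right]; gcongr; exact hr k
      have h2 : ∫⁻ r in Set.Ioc s u,
            ENNReal.ofReal K * ENNReal.ofReal ((1 / 2) ^ n * Real.exp (2 * K * (r - s))) ≤
          ENNReal.ofReal ((1 / 2) ^ (n + 1) * Real.exp (2 * K * (u - s))) := by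
        have h3 := lintegral_mul_exp (κ := fun _ => 2 * K) hu.1 (by simp) (fun _ => by linarith)
        simp only [intervalIntegral.integral_const, smul_eq_mul] at h3
        have h4 : ∀ r, ENNReal.ofReal K *
            ENNReal.ofReal ((1 / 2) ^ n * Real.exp (2 * K * (r - s))) =
            ENNReal.ofReal ((1 / 2) ^ (n + 1)) *
            (ENNReal.ofReal (2 * K) * ENNReal.ofReal (Real.exp ((r - s) * (2 * K)))) := by
          intro r
          rw [← ENNReal.ofReal_mul (by positivity), ← ENNReal.ofReal_mul (by positivity),
            ← ENNReal.ofReal_mul (by positivity), mul_comm (r - s)]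
          congr 1; ring
        simp_rw [h4]
        rw [lintegral_const_mul' _ _ ENNReal.ofReal_ne_top, h3,
          ← ENNReal.ofReal_mul (by positivity)]
        apply ENNReal.ofReal_le_ofReal
        rw [mul_comm (u - s)]
        gcongr
        linarith
      rw [lintegral_add_right _ (by fun_prop)] at h1
      calc _ ≤ Q k s + ((∫⁻ r in Set.Ioc s u, ∑' j, γ k j r * E n j r) +
            ENNReal.ofReal ((1 / 2) ^ (n + 1) * Real.exp (2 * K * (u - s)))) := by
              gcongr; exact h1.trans (add_le_add le_rfl h2)
        _ = _ := by
              rw [← add_assoc]; rfl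
  -- conclude through finite sums
  rw [ENNReal.tsum_eq_iSup_sum]
  refine iSup_le fun T => ?_
  have hlim : Tendsto (fun n : ℕ => M * ENNReal.ofReal (Real.exp (∫ r in s..u, κ r)) +
      (∑ k ∈ T, w k) * ENNReal.ofReal ((1 / 2) ^ n * Real.exp (2 * K * (u - s)))) atTop
      (𝓝 (M * ENNReal.ofReal (Real.exp (∫ r in s..u, κ r)) + (∑ k ∈ T, w k) * 0)) := by
    refine tendsto_const_nhds.add (ENNReal.Tendsto.const_mul ?_ (Or.inr ?_))
    · rw [← ENNReal.ofReal_zero]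
      apply ENNReal.tendsto_ofReal
      have := (tendsto_pow_atTop_nhds_zero_of_lt_one (r := (1 / 2 : ℝ)) (by norm_num)
        (by norm_num)).mul_const (Real.exp (2 * K * (u - s)))
      simpa using this
    · exact ENNReal.sum_ne_top.2 fun k _ => hw k
  rw [mul_zero, add_zero] at hlim
  refine ge_of_tendsto' hlim fun n => ?_
  calc _ ≤ ∑ k ∈ T, (w k * E n k u +
        w k * ENNReal.ofReal ((1 / 2) ^ n * Real.exp (2 * K * (u - s)))) := by
          refine Finset.sum_le_sum fun k _ => ?_
          rw [← mul_add]; gcongr; exact hR n k u hu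
    _ ≤ _ := by
          rw [Finset.sum_add_distrib, ← Finset.sum_mul]
          gcongr
          exact (ENNReal.sum_le_tsum T).trans (hEb n u hu)

lemma core_lower {K : ℝ} (hK : 0 ≤ K) (hst : s ≤ t) (hw : ∀ k, w k ≠ ⊤)
    (hγ : ∀ k j, AEMeasurable (γ k j) (volume.restrict (Set.Ioc s t)))
    (hQm : ∀ k, AEMeasurable (Q k) (volume.restrict (Set.Ioc s t)))
    (hrow : ∀ᵐ r ∂(volume.restrict (Set.Ioc s t)), ∀ k, ∑' j, γ k j r ≤ ENNReal.ofReal K)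
    (hcol : ∀ᵐ r ∂(volume.restrict (Set.Ioc s t)), ∀ j,
      ∑' k, w k * γ k j r ≤ ENNReal.ofReal (κ r) * w j)
    (hκ : IntervalIntegrable κ volume s t) (hκ0 : ∀ v, 0 ≤ κ v)
    (hQ1 : ∀ k, ∀ u ∈ Set.Icc s t, Q k u ≤ 1)
    (hQle : ∀ k, ∀ u ∈ Set.Icc s t,
      Q k u ≤ Q k s + ∫⁻ r in Set.Ioc s u, ∑' j, γ k j r * Q j r)
    (hQge : ∀ k, ∀ u ∈ Set.Icc s t,
      Q k u ≤ Q k t + ∫⁻ r in Set.Ioc u t, ∑' j, γ k j r * Q j r)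
    (hM : ∑' k, w k * Q k s ≠ ⊤) :
    ∑' k, w k * Q k t ≠ ⊤ ∧
      (∑' k, w k * Q k s).toReal ≤
        (∑' k, w k * Q k t).toReal * Real.exp (∫ r in s..t, κ r) := by
  set F : ℝ → ENNReal := fun u => ∑' k, w k * Q k u with hF
  have hb := core_bound hK hw hγ hrow hcol hκ hκ0 hQ1 hQle
  set B : ENNReal := F s * ENNReal.ofReal (Real.exp (∫ r in s..t, κ r)) with hB
  have hBtop : B ≠ ⊤ := ENNReal.mul_ne_top hM ENNReal.ofReal_ne_top
  have hFB : ∀ u ∈ Set.Icc s t, F u ≤ B := by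
    intro u hu
    refine (hb u hu).trans ?_
    simp only [hB, hF]
    gcongr
    apply intervalIntegral.integral_mono_interval le_rfl hu.1 hu.2 _ hκ
    exact Eventually.of_forall fun x => hκ0 x
  have hFtop : ∀ u ∈ Set.Icc s t, F u ≠ ⊤ := fun u hu => ne_top_of_le_ne_top hBtop (hFB u hu)
  have hFm : AEMeasurable F (volume.restrict (Set.Ioc s t)) :=
    AEMeasurable.tsum fun k => (hQm k).const_mul _
  have hint : IntegrableOn (fun v => κ v * (F v).toReal) (Set.Ioc s t) := by
    refine Integrable.mul_bdd (c := B.toReal) hκ.1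
      hFm.ennreal_toReal.aestronglyMeasurable ?_
    filter_upwards [ae_restrict_mem measurableSet_Ioc] with x hx
    rw [Real.norm_of_nonneg ENNReal.toReal_nonneg]
    exact ENNReal.toReal_mono hBtop (hFB x ⟨hx.1.le, hx.2⟩)
  have hint' : IntervalIntegrable (fun v => κ v * (F v).toReal) volume s t :=
    (intervalIntegrable_iff_integrableOn_Ioc_of_le hst).2 hint
  refine ⟨hFtop t ⟨hst, le_rfl⟩, ?_⟩
  refine gronwall_back (F := fun u => (F u).toReal) hst hκ hκ0 hint' fun v hv => ?_
  have h1 : F v ≤ F t + ∫⁻ r in Set.Ioc v t, ENNReal.ofReal (κ r) * F r := by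
    calc F v ≤ ∑' k, (w k * Q k t + w k * ∫⁻ r in Set.Ioc v t, ∑' j, γ k j r * Q j r) := by
          refine ENNReal.tsum_le_tsum fun k => ?_
          rw [← mul_add]; gcongr; exact hQge k v hv
      _ ≤ _ := by
          rw [ENNReal.tsum_add]
          gcongr
          exact sum_lintegral_le hv.1 le_rfl hγ hQm hcol
  have hnn : 0 ≤ ∫ r in v..t, κ r * (F r).toReal :=
    intervalIntegral.integral_nonneg hv.2 fun x _ => mul_nonneg (hκ0 x) ENNReal.toReal_nonneg
  have h2 : ∫⁻ r in Set.Ioc v t, ENNReal.ofReal (κ r) * F r =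
      ENNReal.ofReal (∫ r in v..t, κ r * (F r).toReal) := by
    rw [intervalIntegral.integral_of_le hv.2, ofReal_integral_eq_lintegral_ofReal]
    · apply setLIntegral_congr_fun measurableSet_Ioc
      intro r hr
      simp only
      rw [ENNReal.ofReal_mul (hκ0 r), ENNReal.ofReal_toReal
        (hFtop r ⟨hv.1.trans hr.1.le, hr.2⟩)]
    · exact hint.mono_set (Set.Ioc_subset_Ioc hv.1 le_rfl)
    · exact Eventually.of_forall fun x => mul_nonneg (hκ0 x) ENNReal.toReal_nonneg
  rw [h2] at h1
  have h3 := ENNReal.toReal_mono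
    (ENNReal.add_ne_top.2 ⟨hFtop t ⟨hst, le_rfl⟩, ENNReal.ofReal_ne_top⟩) h1
  rwa [ENNReal.toReal_add (hFtop t ⟨hst, le_rfl⟩) ENNReal.ofReal_ne_top,
    ENNReal.toReal_ofReal hnn] at h3

end core

section pointwise
variable {A : ℕ → ℕ → ℝ} {L : ℝ}

/-- Tail column sums `Σ_{i ≥ k} A i j`, written as a finite sum. -/
def tl (A : ℕ → ℕ → ℝ) (k j : ℕ) : ℝ := -∑ i ∈ Finset.range k, A i j

/-- Differences of consecutive tail column sums. -/
def cc (A : ℕ → ℕ → ℝ) (k j : ℕ) : ℝ := tl A k (j + 1) - tl A k j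

lemma entry_le (hoff : ∀ i j, i ≠ j → 0 ≤ A i j) (hcs : ∀ j, HasSum (fun i => A i j) 0)
    (hL : ∀ j, |A j j| ≤ L) (i j : ℕ) : |A i j| ≤ L := by
  by_cases h : i = j
  · subst h; exact hL i
  · rw [abs_of_nonneg (hoff i j h)]
    have := sum_le_hasSum {i, j} (fun m hm => hoff m j (by
      intro h'; subst h'; simp at hm)) (hcs j)
    rw [Finset.sum_pair h] at this
    have := (abs_le.1 (hL j)).1
    linarith

lemma tl_le (hoff : ∀ i j, i ≠ j → 0 ≤ A i j) (hcs : ∀ j, HasSum (fun i => A i j) 0)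
    (hL : ∀ j, |A j j| ≤ L) (k j : ℕ) : |tl A k j| ≤ L := by
  have hj := abs_le.1 (hL j)
  have hL0 : 0 ≤ L := (abs_nonneg _).trans (hL j)
  unfold tl
  rw [abs_neg, abs_le]
  by_cases h : j < k
  · constructor
    · have := Finset.sum_erase_add (Finset.range k) (fun i => A i j) (Finset.mem_range.2 h)
      have h2 : 0 ≤ ∑ i ∈ (Finset.range k).erase j, A i j :=
        Finset.sum_nonneg fun i hi => hoff i j (Finset.ne_of_mem_erase hi)
      linarith
    · have := sum_le_hasSum (Finset.range k) (fun m hm => hoff m j (by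
        intro h'; subst h'; simp at hm; omega)) (hcs j)
      linarith
  · constructor
    · have h2 : 0 ≤ ∑ i ∈ Finset.range k, A i j :=
        Finset.sum_nonneg fun i hi => hoff i j (by
          intro h'; subst h'; exact h (Finset.mem_range.1 hi))
      linarith
    · have := sum_le_hasSum (insert j (Finset.range k)) (fun m hm => hoff m j (by
        intro h'; subst h'; simp at hm)) (hcs j)
      rw [Finset.sum_insert (by simpa using h)] at this
      linarith

lemma tl_hasSum (hcs : ∀ j, HasSum (fun i => A i j) 0) (k j : ℕ) :
    HasSum (fun i => A (k + i) j) (tl A k j) := by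
  have := (hasSum_nat_add_iff' (f := fun i => A i j) k).2 (hcs j)
  simpa [tl, add_comm] using this

lemma cc_row (hoff : ∀ i j, i ≠ j → 0 ≤ A i j) (hcs : ∀ j, HasSum (fun i => A i j) 0)
    (hL : ∀ j, |A j j| ≤ L) (k m : ℕ) (hcc : ∀ j, j ≠ m → 0 ≤ cc A k j) :
    ∑' j, ENNReal.ofReal |cc A k j| ≤ ENNReal.ofReal (6 * L) := by
  have htl := tl_le hoff hcs hL k
  have hL0 : 0 ≤ L := (abs_nonneg _).trans (hL 0)
  refine ENNReal.tsum_le_of_sum_range_le fun n => ?_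
  rw [← ENNReal.ofReal_sum_of_nonneg fun _ _ => abs_nonneg _]
  apply ENNReal.ofReal_le_ofReal
  have h1 : ∀ j, |cc A k j| ≤ cc A k j + (if j = m then 4 * L else 0) := by
    intro j
    split_ifs with h
    · have a1 := abs_le.1 (htl j)
      have a2 := abs_le.1 (htl (j + 1))
      unfold cc
      rw [abs_le]; constructor <;> linarith
    · rw [abs_of_nonneg (hcc j h), add_zero]
  refine (Finset.sum_le_sum fun j _ => h1 j).trans ?_
  rw [Finset.sum_add_distrib]
  have h2 : ∑ j ∈ Finset.range n, cc A k j = tl A k n - tl A k 0 :=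
    Finset.sum_range_sub (tl A k) n
  have h3 : ∑ j ∈ Finset.range n, (if j = m then 4 * L else 0) ≤ 4 * L := by
    rw [Finset.sum_ite_eq']
    split_ifs <;> linarith
  have a1 := abs_le.1 (htl 0)
  have a2 := abs_le.1 (htl n)
  linarith

lemma abel_bound (htl : ∀ k j, |tl A k j| ≤ L) {x : ℕ → ℝ} (hx : HasSum x 0) (k : ℕ) {g : ℝ}
    (hg : HasSum (fun j => tl A k j * x j) g) :
    ENNReal.ofReal |g| ≤ ∑' j, ENNReal.ofReal |cc A k j| *
      ENNReal.ofReal |∑ i ∈ Finset.range (j + 1), x i| := by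
  have hid : ∀ J : ℕ, ∑ j ∈ Finset.range (J + 1), tl A k j * x j =
      -∑ j ∈ Finset.range J, cc A k j * (∑ i ∈ Finset.range (j + 1), x i) +
        tl A k J * ∑ i ∈ Finset.range (J + 1), x i := by
    intro J
    induction J with
    | zero => simp
    | succ J ih =>
      rw [Finset.sum_range_succ, ih,
        Finset.sum_range_succ (fun j => cc A k j * ∑ i ∈ Finset.range (j + 1), x i) J,
        Finset.sum_range_succ (fun i => x i) (J + 1)]
      have hc : cc A k J = tl A k (J + 1) - tl A k J := rfl
      rw [hc]
      ring
  have hq : Tendsto (fun J => ∑ i ∈ Finset.range (J + 1), x i) atTop (𝓝 0) :=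
    (tendsto_add_atTop_iff_nat 1).2 hx.tendsto_sum_nat
  have hl : Tendsto (fun J => ∑ j ∈ Finset.range (J + 1), tl A k j * x j) atTop (𝓝 g) :=
    (tendsto_add_atTop_iff_nat 1).2 hg.tendsto_sum_nat
  have hl2 := ENNReal.tendsto_ofReal hl.abs
  have hr : Tendsto (fun J => (∑' j, ENNReal.ofReal |cc A k j| *
      ENNReal.ofReal |∑ i ∈ Finset.range (j + 1), x i|) +
      ENNReal.ofReal (L * |∑ i ∈ Finset.range (J + 1), x i|)) atTop
      (𝓝 ((∑' j, ENNReal.ofReal |cc A k j| *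
      ENNReal.ofReal |∑ i ∈ Finset.range (j + 1), x i|) + 0)) := by
    refine tendsto_const_nhds.add ?_
    rw [← ENNReal.ofReal_zero]
    apply ENNReal.tendsto_ofReal
    simpa using hq.abs.const_mul L
  rw [add_zero] at hr
  refine le_of_tendsto_of_tendsto' hl2 hr fun J => ?_
  rw [hid J]
  calc _ ≤ ENNReal.ofReal ((∑ j ∈ Finset.range J,
          |cc A k j| * |∑ i ∈ Finset.range (j + 1), x i|) +
          L * |∑ i ∈ Finset.range (J + 1), x i|) := by
        apply ENNReal.ofReal_le_ofReal
        refine (abs_add_le _ _).trans ?_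
        rw [abs_neg, abs_mul]
        gcongr
        · refine (Finset.abs_sum_le_sum_abs _ _).trans ?_
          simp_rw [abs_mul]; exact le_rfl
        · exact htl k J
    _ ≤ _ := by
        refine ENNReal.ofReal_add_le.trans ?_
        gcongr
        rw [ENNReal.ofReal_sum_of_nonneg fun _ _ => by positivity]
        simp_rw [ENNReal.ofReal_mul (abs_nonneg _)]
        exact ENNReal.sum_le_tsum _

end pointwise

lemma bStar_eq (d : ℕ → ℝ) (a : ℕ → ℕ → ℝ → ℝ) (r : ℝ)
    (hcs : ∀ j, HasSum (fun i => a i j r) 0) (i j : ℕ) :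
    bStar d a i (j + 1) r = d i / d (j + 1) * cc (fun i j => a i j r) i j := by
  unfold bStar
  have hb : ∀ m, HasSum (fun k => bEntry a (i + k) m r)
      (tl (fun i j => a i j r) i m - tl (fun i j => a i j r) i 0) := by
    intro m
    by_cases hm : m = 0
    · subst hm; simp [bEntry, hasSum_zero]
    · simp only [bEntry, hm, if_false]
      exact (tl_hasSum (A := fun i j => a i j r) hcs i m).sub (tl_hasSum hcs i 0)
  rw [((hb (j + 1)).sub (hb (j + 1 - 1))).tsum_eq]
  simp only [Nat.add_sub_cancel, cc]
  ring

lemma cc_col {d : ℕ → ℝ} {a : ℕ → ℕ → ℝ → ℝ} {r : ℝ} (hdpos : ∀ k, 1 ≤ k → 0 < d k)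
    (hcs : ∀ j, HasSum (fun i => a i j r) 0)
    (hsum : ∀ i : ℕ, Summable (fun j : ℕ => |bStar d a (j + 1) (i + 1) r|))
    (hbdd : BddAbove (Set.range fun i : ℕ => ∑' j : ℕ, |bStar d a (j + 1) (i + 1) r|)) (j : ℕ) :
    ∑' k, ENNReal.ofReal (d (k + 1)) * ENNReal.ofReal |cc (fun i j => a i j r) (k + 1) j| ≤
      ENNReal.ofReal (chiSup d a r) * ENNReal.ofReal (d (j + 1)) := by
  have hp : ∀ k, 0 < d (k + 1) := fun k => hdpos (k + 1) (by omega)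
  have h1 : ∀ k, ENNReal.ofReal (d (k + 1)) *
      ENNReal.ofReal |cc (fun i j => a i j r) (k + 1) j| =
      ENNReal.ofReal |bStar d a (k + 1) (j + 1) r| * ENNReal.ofReal (d (j + 1)) := by
    intro k
    rw [← ENNReal.ofReal_mul (hp k).le, ← ENNReal.ofReal_mul (abs_nonneg _), bStar_eq d a r hcs,
      abs_mul, abs_of_pos (div_pos (hp k) (hp j))]
    congr 1
    have := (hp j).ne'
    field_simp
  simp_rw [h1]
  rw [ENNReal.tsum_mul_right]
  gcongr
  rw [← ENNReal.ofReal_tsum_of_nonneg (fun _ => abs_nonneg _) (hsum j)]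
  exact ENNReal.ofReal_le_ofReal (le_ciSup hbdd j)

lemma chiSup_nonneg (d : ℕ → ℝ) (a : ℕ → ℕ → ℝ → ℝ) (r : ℝ) : 0 ≤ chiSup d a r :=
  Real.iSup_nonneg fun _ => tsum_nonneg fun _ => abs_nonneg _

section sol
variable {a : ℕ → ℕ → ℝ → ℝ} {p : ℝ → ℕ → ℝ} {L : ℝ}

lemma row_summable {A : ℕ → ℕ → ℝ} (hA : ∀ i j, |A i j| ≤ L) {x : ℕ → ℝ}
    (hx : Summable fun j => |x j|) (i : ℕ) : Summable (fun j => A i j * x j) := by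
  refine Summable.of_norm_bounded (g := fun j => L * |x j|) (hx.mul_left L) fun j => ?_
  rw [Real.norm_eq_abs, abs_mul]
  gcongr
  exact hA i j

lemma row_bound {A : ℕ → ℕ → ℝ} (hA : ∀ i j, |A i j| ≤ L) {x : ℕ → ℝ}
    (hx0 : ∀ j, 0 ≤ x j) (hx : HasSum x 1) (i : ℕ) : ‖∑' j, A i j * x j‖ ≤ L := by
  refine tsum_of_norm_bounded (g := fun j => L * x j) (by simpa using hx.mul_left L) fun j => ?_
  rw [Real.norm_eq_abs, abs_mul, abs_of_nonneg (hx0 j)]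
  gcongr
  · exact hx0 j
  · exact hA i j

lemma sol_lip (hp : IsKolmogorovSolution a p) (hL0 : 0 ≤ L)
    (hA : ∀ᵐ r : ℝ, 0 ≤ r → ∀ i j, |a i j r| ≤ L) (i : ℕ) :
    ContinuousOn (fun r => p r i) (Set.Ici 0) := by
  have hb : ∀ v u, 0 ≤ v → v ≤ u → |p u i - p v i| ≤ L * |u - v| := by
    intro v u hv hvu
    rw [hp.2 i v u hv hvu, add_sub_cancel_left, ← Real.norm_eq_abs]
    apply intervalIntegral.norm_integral_le_of_norm_le_const_ae
    filter_upwards [hA] with r hr hrm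
    rw [Set.uIoc_of_le hvu] at hrm
    have hr0 : 0 ≤ r := hv.trans hrm.1.le
    exact row_bound (A := fun i j => a i j r) (hr hr0) (hp.1 r hr0).1 (hp.1 r hr0).2 i
  have : LipschitzOnWith L.toNNReal (fun r => p r i) (Set.Ici 0) := by
    refine LipschitzOnWith.of_dist_le_mul fun u hu v hv => ?_
    rw [Real.coe_toNNReal L hL0, Real.dist_eq, Real.dist_eq]
    rcases le_total v u with h | h
    · exact hb v u hv h
    · rw [abs_sub_comm, abs_sub_comm u]; exact hb u v hu h
  exact this.continuousOn

lemma sol_integrable (hp : IsKolmogorovSolution a p) (hL0 : 0 ≤ L)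
    (haloc : ∀ i j, LocallyIntegrableOn (a i j) (Set.Ici 0))
    (hA : ∀ᵐ r : ℝ, 0 ≤ r → ∀ i j, |a i j r| ≤ L) (i : ℕ) {v u : ℝ} (hv : 0 ≤ v)
    (hvu : v ≤ u) :
    IntervalIntegrable (fun r => ∑' j, a i j r * p r j) volume v u := by
  rw [intervalIntegrable_iff_integrableOn_Ioc_of_le hvu]
  have hsub : Set.Ioc v u ⊆ Set.Ici 0 := fun r hr => hv.trans hr.1.le
  have hgood : ∀ᵐ r ∂(volume.restrict (Set.Ioc v u)), 0 ≤ r ∧ ∀ i j, |a i j r| ≤ L := by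
    filter_upwards [ae_restrict_of_ae hA, ae_restrict_mem measurableSet_Ioc] with r h1 h2
    exact ⟨hsub h2, h1 (hsub h2)⟩
  have hm : AEStronglyMeasurable (fun r => ∑' j, a i j r * p r j)
      (volume.restrict (Set.Ioc v u)) := by
    refine aestronglyMeasurable_of_tendsto_ae atTop
      (f := fun n r => ∑ j ∈ Finset.range n, a i j r * p r j) (fun n => ?_) ?_
    · refine Finset.aestronglyMeasurable_fun_sum _ fun j _ => ?_
      refine AEStronglyMeasurable.mul ?_ ?_
      · exact (haloc i j).aestronglyMeasurable.mono_measure (Measure.restrict_mono hsub le_rfl)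
      · exact ((sol_lip hp hL0 hA j).mono hsub).aestronglyMeasurable measurableSet_Ioc
    · filter_upwards [hgood] with r hr
      have hs := (hp.1 r hr.1)
      exact (row_summable (A := fun i j => a i j r) hr.2 (x := p r)
        (hs.2.summable.congr fun j => (abs_of_nonneg (hs.1 j)).symm) i).hasSum.tendsto_sum_nat
  refine Integrable.mono' (g := fun _ => L) (by simp) hm ?_
  filter_upwards [hgood] with r hr
  exact row_bound (A := fun i j => a i j r) hr.2 (hp.1 r hr.1).1 (hp.1 r hr.1).2 i

lemma diff_bound {p₁ p₂ : ℝ → ℕ → ℝ} (hp₁ : IsKolmogorovSolution a p₁)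
    (hp₂ : IsKolmogorovSolution a p₂) (hL0 : 0 ≤ L)
    (haloc : ∀ i j, LocallyIntegrableOn (a i j) (Set.Ici 0))
    (hA : ∀ᵐ r : ℝ, 0 ≤ r → ∀ i j, |a i j r| ≤ L)
    (hT : ∀ᵐ r : ℝ, 0 ≤ r → ∀ k j, |tl (fun i j => a i j r) k j| ≤ L)
    (k : ℕ) {v u : ℝ} (hv : 0 ≤ v) (hvu : v ≤ u) :
    ENNReal.ofReal |(∑ i ∈ Finset.range k, (p₁ u i - p₂ u i)) -
        ∑ i ∈ Finset.range k, (p₁ v i - p₂ v i)| ≤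
      ∫⁻ r in Set.Ioc v u, ∑' j, ENNReal.ofReal |cc (fun i j => a i j r) k j| *
        ENNReal.ofReal |∑ i ∈ Finset.range (j + 1), (p₁ r i - p₂ r i)| := by
  have hi : ∀ i, IntervalIntegrable
      (fun r => (∑' j, a i j r * p₁ r j) - ∑' j, a i j r * p₂ r j) volume v u := fun i =>
    (sol_integrable hp₁ hL0 haloc hA i hv hvu).sub (sol_integrable hp₂ hL0 haloc hA i hv hvu)
  have h1 : (∑ i ∈ Finset.range k, (p₁ u i - p₂ u i)) -
        ∑ i ∈ Finset.range k, (p₁ v i - p₂ v i) =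
      ∫ r in v..u, ∑ i ∈ Finset.range k,
        ((∑' j, a i j r * p₁ r j) - ∑' j, a i j r * p₂ r j) := by
    rw [intervalIntegral.integral_finsetSum fun i _ => hi i, ← Finset.sum_sub_distrib]
    refine Finset.sum_congr rfl fun i _ => ?_
    rw [intervalIntegral.integral_sub (sol_integrable hp₁ hL0 haloc hA i hv hvu)
      (sol_integrable hp₂ hL0 haloc hA i hv hvu), hp₁.2 i v u hv hvu, hp₂.2 i v u hv hvu]
    ring
  rw [h1, intervalIntegral.integral_of_le hvu, ← Real.enorm_eq_ofReal_abs]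
  refine (enorm_integral_le_lintegral_enorm _).trans ?_
  apply lintegral_mono_ae
  filter_upwards [ae_restrict_of_ae hA, ae_restrict_of_ae hT,
    ae_restrict_mem measurableSet_Ioc] with r hr1 hr2 hr3
  have hr0 : 0 ≤ r := hv.trans hr3.1.le
  have s1 := hp₁.1 r hr0
  have s2 := hp₂.1 r hr0
  have hx : HasSum (fun j => p₁ r j - p₂ r j) 0 := by simpa using s1.2.sub s2.2
  have hrow : ∀ i, HasSum (fun j => a i j r * (p₁ r j - p₂ r j))
      ((∑' j, a i j r * p₁ r j) - ∑' j, a i j r * p₂ r j) := by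
    intro i
    have e1 := (row_summable (A := fun i j => a i j r) (hr1 hr0) (x := p₁ r)
        (s1.2.summable.congr fun j => (abs_of_nonneg (s1.1 j)).symm) i).hasSum
    have e2 := (row_summable (A := fun i j => a i j r) (hr1 hr0) (x := p₂ r)
        (s2.2.summable.congr fun j => (abs_of_nonneg (s2.1 j)).symm) i).hasSum
    simpa [mul_sub] using e1.sub e2
  have hg : HasSum (fun j => tl (fun i j => a i j r) k j * (p₁ r j - p₂ r j))
      (-∑ i ∈ Finset.range k, ((∑' j, a i j r * p₁ r j) - ∑' j, a i j r * p₂ r j)) := by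
    have := (hasSum_sum (s := Finset.range k) fun i _ => hrow i).neg
    refine this.congr_fun ?_
    intro j
    simp only [tl, neg_mul, Finset.sum_mul]
  have := abel_bound (hr2 hr0) hx k hg
  rwa [abs_neg, ← Real.enorm_eq_ofReal_abs] at this

end sol

/-- Theorem 1, lower bound in (t001).  For any two solutions `p*`, `p**`
of the forward Kolmogorov system and any `0 ≤ s ≤ t` with `‖p*(s) − p**(s)‖_{1D} < ∞`,
`‖p*(t) − p**(t)‖_{1D} ≥ exp(−∫_s^t χ(u) du) · ‖p*(s) − p**(s)‖_{1D}`. -/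
theorem thm1_t001_lower
    (a : ℕ → ℕ → ℝ → ℝ) (d : ℕ → ℝ) (L : ℝ)
    (hd1 : d 1 = 1) (hdpos : ∀ k, 1 ≤ k → 0 < d k)
    (hdmono : ∀ k, 1 ≤ k → d k ≤ d (k + 1))
    (haloc : ∀ i j, LocallyIntegrableOn (a i j) (Set.Ici 0))
    (haoff : ∀ i j, i ≠ j → ∀ t : ℝ, 0 ≤ t → 0 ≤ a i j t)
    (hadiag : ∀ j, ∀ t : ℝ, 0 ≤ t → HasSum (fun i => a i j t) 0)
    (haL : ∀ᵐ t : ℝ, 0 ≤ t → ∀ j, |a j j t| ≤ L)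
    (hbstar : ∀ᵐ t : ℝ, 0 ≤ t → ∀ i j, 1 ≤ i → 1 ≤ j → i ≠ j → 0 ≤ bStar d a i j t)
    (hχfin : ∀ᵐ t : ℝ, 0 ≤ t →
      (∀ i : ℕ, Summable (fun j : ℕ => |bStar d a (j + 1) (i + 1) t|)) ∧
        BddAbove (Set.range fun i : ℕ => ∑' j : ℕ, |bStar d a (j + 1) (i + 1) t|))
    (hχloc : LocallyIntegrableOn (chiSup d a) (Set.Ici 0))
    (p₁ p₂ : ℝ → ℕ → ℝ)
    (hp₁ : IsKolmogorovSolution a p₁) (hp₂ : IsKolmogorovSolution a p₂)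
    (s t : ℝ) (hs : 0 ≤ s) (hst : s ≤ t)
    (hfin : Norm1DFinite d (fun k => p₁ s k - p₂ s k)) :
    Real.exp (-∫ u in s..t, chiSup d a u) *
        norm1D d (fun k => p₁ s k - p₂ s k) ≤
      norm1D d (fun k => p₁ t k - p₂ t k) := by
  obtain ⟨L, hL0, haL⟩ : ∃ L' : ℝ, 0 ≤ L' ∧ ∀ᵐ t : ℝ, 0 ≤ t → ∀ j, |a j j t| ≤ L' :=
    ⟨|L|, abs_nonneg _, haL.mono fun r h hr j => (h hr j).trans (le_abs_self L)⟩
  have hA : ∀ᵐ r : ℝ, 0 ≤ r → ∀ i j, |a i j r| ≤ L := by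
    filter_upwards [haL] with r h hr i j
    exact entry_le (A := fun i j => a i j r) (fun i j hij => haoff i j hij r hr)
      (fun j => hadiag j r hr) (h hr) i j
  have hT : ∀ᵐ r : ℝ, 0 ≤ r → ∀ k j, |tl (fun i j => a i j r) k j| ≤ L := by
    filter_upwards [haL] with r h hr k j
    exact tl_le (A := fun i j => a i j r) (fun i j hij => haoff i j hij r hr)
      (fun j => hadiag j r hr) (h hr) k j
  have hp : ∀ k, 0 < d (k + 1) := fun k => hdpos (k + 1) (by omega)
  have hsub : Set.Ioc s t ⊆ Set.Ici 0 := fun r hr => hs.trans hr.1.le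
  set w : ℕ → ENNReal := fun k => ENNReal.ofReal (d (k + 1)) with hw
  set Q : ℕ → ℝ → ENNReal := fun k u =>
    ENNReal.ofReal |∑ i ∈ Finset.range (k + 1), (p₁ u i - p₂ u i)| with hQ
  set γ : ℕ → ℕ → ℝ → ENNReal := fun k j r =>
    ENNReal.ofReal |cc (fun i j => a i j r) (k + 1) j| with hγ
  -- identification of the norm
  have htail : ∀ u, 0 ≤ u → ∀ k, |∑' i : ℕ, (p₁ u (k + 1 + i) - p₂ u (k + 1 + i))| =
      |∑ i ∈ Finset.range (k + 1), (p₁ u i - p₂ u i)| := by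
    intro u hu k
    have hx : HasSum (fun j => p₁ u j - p₂ u j) 0 := by
      simpa using (hp₁.1 u hu).2.sub (hp₂.1 u hu).2
    have h2 := hx.summable.sum_add_tsum_nat_add (k + 1)
    rw [hx.tsum_eq] at h2
    have h3 : ∑' i : ℕ, (p₁ u (k + 1 + i) - p₂ u (k + 1 + i)) =
        ∑' i : ℕ, (p₁ u (i + (k + 1)) - p₂ u (i + (k + 1))) := by
      simp_rw [add_comm (k + 1)]
    rw [h3, eq_neg_of_add_eq_zero_right h2, abs_neg]
  have hnorm : ∀ u, 0 ≤ u → norm1D d (fun k => p₁ u k - p₂ u k) =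
      (∑' k, w k * Q k u).toReal := by
    intro u hu
    rw [ENNReal.tsum_toReal_eq fun k => ENNReal.mul_ne_top ENNReal.ofReal_ne_top
      ENNReal.ofReal_ne_top]
    unfold norm1D
    refine tsum_congr fun k => ?_
    rw [ENNReal.toReal_mul, ENNReal.toReal_ofReal (hp k).le,
      ENNReal.toReal_ofReal (abs_nonneg _), htail u hu k]
  have hM : ∑' k, w k * Q k s ≠ ⊤ := by
    have h1 := hfin.tsum_ofReal_ne_top
    convert h1 using 3 with k
    rw [ENNReal.ofReal_mul (hp k).le, htail s hs k]
  have hxm : ∀ i, AEMeasurable (fun r => p₁ r i - p₂ r i) (volume.restrict (Set.Ioc s t)) :=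
    fun i => ((((sol_lip hp₁ hL0 hA i).sub (sol_lip hp₂ hL0 hA i)).mono hsub).aestronglyMeasurable
      measurableSet_Ioc).aemeasurable
  have ham : ∀ i j, AEMeasurable (a i j) (volume.restrict (Set.Ioc s t)) := fun i j =>
    ((haloc i j).aestronglyMeasurable.mono_measure
      (Measure.restrict_mono hsub le_rfl)).aemeasurable
  have htri : ∀ x y : ℝ, ENNReal.ofReal |x| ≤ ENNReal.ofReal |y| + ENNReal.ofReal |x - y| := by
    intro x y
    rw [← ENNReal.ofReal_add (abs_nonneg _) (abs_nonneg _)]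
    apply ENNReal.ofReal_le_ofReal
    have := abs_add_le y (x - y)
    simpa using this
  have main := core_lower (γ := γ) (Q := Q) (w := w) (κ := chiSup d a) (s := s) (t := t)
    (K := 6 * L) (by positivity) hst (fun k => ENNReal.ofReal_ne_top) ?_ ?_ ?_ ?_ ?_
    (chiSup_nonneg d a) ?_ ?_ ?_ hM
  · rw [hnorm s hs, hnorm t (hs.trans hst), Real.exp_neg, inv_mul_le_iff₀ (Real.exp_pos _),
      mul_comm]
    exact main.2
  · intro k j
    have : AEMeasurable (fun r => cc (fun i j => a i j r) (k + 1) j)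
        (volume.restrict (Set.Ioc s t)) := by
      unfold cc tl
      exact ((Finset.aemeasurable_fun_sum _ fun i _ => ham i (j + 1)).neg).sub
        ((Finset.aemeasurable_fun_sum _ fun i _ => ham i j).neg)
    exact (this.norm).ennreal_ofReal
  · intro k
    exact (Finset.aemeasurable_fun_sum _ fun i _ => hxm i).norm.ennreal_ofReal
  · filter_upwards [ae_restrict_of_ae haL, ae_restrict_of_ae hbstar,
      ae_restrict_mem measurableSet_Ioc] with r h1 h2 h3 k
    have hr := hsub h3
    refine cc_row (A := fun i j => a i j r) (fun i j hij => haoff i j hij r hr)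
      (fun j => hadiag j r hr) (h1 hr) (k + 1) k fun j hj => ?_
    have h4 := h2 hr (k + 1) (j + 1) (by omega) (by omega) (by omega)
    rw [bStar_eq d a r (fun j => hadiag j r hr)] at h4
    exact nonneg_of_mul_nonneg_right h4 (div_pos (hp k) (hp j))
  · filter_upwards [ae_restrict_of_ae hχfin, ae_restrict_mem measurableSet_Ioc] with r h1 h3 j
    have hr := hsub h3
    exact cc_col hdpos (fun j => hadiag j r hr) (h1 hr).1 (h1 hr).2 j
  · rw [intervalIntegrable_iff_integrableOn_Icc_of_le hst]
    exact hχloc.integrableOn_compact_subset (fun r hr => hs.trans hr.1) isCompact_Icc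
  · intro k u hu
    have hu0 := hs.trans hu.1
    have s1 := hp₁.1 u hu0
    have s2 := hp₂.1 u hu0
    have b1 := sum_le_hasSum (Finset.range (k + 1)) (fun i _ => s1.1 i) s1.2
    have b2 := sum_le_hasSum (Finset.range (k + 1)) (fun i _ => s2.1 i) s2.2
    have c1 := Finset.sum_nonneg fun i (_ : i ∈ Finset.range (k + 1)) => s1.1 i
    have c2 := Finset.sum_nonneg fun i (_ : i ∈ Finset.range (k + 1)) => s2.1 i
    rw [← ENNReal.ofReal_one]
    apply ENNReal.ofReal_le_ofReal
    rw [Finset.sum_sub_distrib, abs_le]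
    constructor <;> linarith
  · intro k u hu
    refine (htri _ _).trans (add_le_add le_rfl ?_)
    exact diff_bound hp₁ hp₂ hL0 haloc hA hT (k + 1) hs hu.1
  · intro k u hu
    refine (htri _ _).trans (add_le_add le_rfl ?_)
    rw [abs_sub_comm]
    exact diff_bound hp₁ hp₂ hL0 haloc hA hT (k + 1) (hs.trans hu.1) hu.2
end
end

section
/- (Ergodicity bound for the inhomogeneous birth–death queue, class I.) For any two solutions p*, p** of the forward Kolmogorov system of the birth–death process and any 0 ≤ s ≤ t with ‖z*(s) − z**(s)‖_{1D} < ∞, one has ‖p*(t) − p**(t)‖ ≤ 4·exp(−∫_s^t α(u) du)·‖z*(s) − z**(s)‖_{1D}, where α(t) = inf_{j≥1} [ μ_j(t) + λ_{j−1}(t) − (d_{j−1}/d_j)·μ_{j−1}(t) − (d_{j+1}/d_j)·λ_j(t) ] (with the convention that the term (d_0/d_1)μ_0 is 0). Consequently, if ∫_0^∞ α(t) dt = +∞, then ‖p*(t) − p**(t)‖ → 0 as t → ∞ (the chain is weakly ergodic). -/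
open MeasureTheory intervalIntegral Filter
open scoped Topology

noncomputable section

/-- The transposed intensity matrix of an inhomogeneous birth–death process with birth
intensities `λ_n` and death intensities `μ_n` (with `μ_0 := 0`):
`a_{n+1,n}(t) = λ_n(t)`, `a_{n−1,n}(t) = μ_n(t)`, `a_{nn}(t) = −(λ_n(t) + μ_n(t))`. -/
def bdMatrix (lam mu : ℕ → ℝ → ℝ) (i j : ℕ) (t : ℝ) : ℝ :=
  if i = j + 1 then lam j t
  else if i + 1 = j then mu j t
  else if i = j then -(lam j t + mu j t)
  else 0

/-- `α(t) = inf_{j≥1} [μ_j(t) + λ_{j−1}(t) − (d_{j−1}/d_j)μ_{j−1}(t)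
  − (d_{j+1}/d_j)λ_j(t)]` (the index `j` below stands for `j+1 ≥ 1`; the term
`(d_0/d_1)μ_0` vanishes since `μ_0 = 0`). -/
def alphaBD (d : ℕ → ℝ) (lam mu : ℕ → ℝ → ℝ) (t : ℝ) : ℝ :=
  ⨅ j : ℕ, (mu (j + 1) t + lam j t - (d j / d (j + 1)) * mu j t
    - (d (j + 2) / d (j + 1)) * lam (j + 1) t)


lemma ac_lip_comp {φ f : ℝ → ℝ} {a b : ℝ} {K : NNReal} {s : Set ℝ}
    (hf : AbsolutelyContinuousOnInterval f a b) (hφ : LipschitzOnWith K φ s)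
    (hs : ∀ x ∈ Set.uIcc a b, f x ∈ s) :
    AbsolutelyContinuousOnInterval (fun x => φ (f x)) a b := by
  have h0 : Tendsto (fun E : ℕ × (ℕ → ℝ × ℝ) =>
      (K:ℝ) * ∑ i ∈ Finset.range E.1, dist (f (E.2 i).1) (f (E.2 i).2))
      (AbsolutelyContinuousOnInterval.totalLengthFilter ⊓
        𝓟 (AbsolutelyContinuousOnInterval.disjWithin a b)) (𝓝 0) := by
    simpa using Tendsto.const_mul (K:ℝ) hf
  refine squeeze_zero' (Eventually.of_forall fun E => Finset.sum_nonneg fun _ _ => dist_nonneg) ?_ h0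
  have : ∀ᶠ E in (AbsolutelyContinuousOnInterval.totalLengthFilter ⊓
        𝓟 (AbsolutelyContinuousOnInterval.disjWithin a b)),
        E ∈ AbsolutelyContinuousOnInterval.disjWithin a b :=
    mem_inf_of_right (mem_principal_self _)
  filter_upwards [this] with E hE
  rw [Finset.mul_sum]
  refine Finset.sum_le_sum fun i hi => ?_
  exact hφ.dist_le_mul _ (hs _ (hE.1 i hi).1) _ (hs _ (hE.1 i hi).2)

lemma ac_abs {f : ℝ → ℝ} {a b : ℝ}
    (hf : AbsolutelyContinuousOnInterval f a b) :
    AbsolutelyContinuousOnInterval (fun x => |f x|) a b := by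
  refine ac_lip_comp (φ := fun x => |x|) (K := 1) (s := Set.univ) hf ?_ (by simp)
  refine LipschitzOnWith.of_dist_le_mul fun x _ y _ => ?_
  simpa [Real.dist_eq] using abs_abs_sub_abs_le x y

lemma ac_sum {f : ℕ → ℝ → ℝ} {a b : ℝ} (N : ℕ)
    (hf : ∀ k, AbsolutelyContinuousOnInterval (f k) a b) :
    AbsolutelyContinuousOnInterval (fun x => ∑ k ∈ Finset.range N, f k x) a b := by
  induction N with
  | zero =>
    simp only [Finset.range_zero, Finset.sum_empty]
    simpa using (hf 0).const_mul 0
  | succ n ih =>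
    simp only [Finset.sum_range_succ]
    exact ih.add (hf n)

lemma gron {V β R : ℝ → ℝ} {s t : ℝ} (hst : s ≤ t)
    (hV : AbsolutelyContinuousOnInterval V s t)
    (hβ : IntervalIntegrable β volume s t) (hR : IntervalIntegrable R volume s t)
    (hd : ∀ᵐ x, x ∈ Set.Icc s t → deriv V x ≤ β x * V x + R x) :
    Real.exp (-∫ u in s..t, β u) * V t ≤
      V s + ∫ u in s..t, Real.exp (-∫ v in s..u, β v) * R u := by
  have hG := hβ.absolutelyContinuousOnInterval_intervalIntegral (c := s) Set.left_mem_uIcc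
  have hE := ac_exp hG.neg
  have hW := hE.fun_mul hV
  have h1 := hW.integral_deriv_eq_sub
  have h2 : ∫ x in s..t, deriv (fun x => Real.exp ((-fun x => ∫ v in s..x, β v) x) * V x) x ≤
      ∫ u in s..t, Real.exp (-∫ v in s..u, β v) * R u := by
    refine integral_mono_ae_restrict hst hW.intervalIntegrable_deriv
      (hR.continuousOn_mul hE.continuousOn) ?_
    rw [EventuallyLE, ae_restrict_iff' measurableSet_Icc]
    filter_upwards [hd, hV.ae_differentiableAt, hβ.ae_hasDerivAt_integral] with x h1 h2 h3 hx
    have hx' : x ∈ Set.uIcc s t := by rwa [Set.uIcc_of_le hst]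
    have hg := h3 hx' s Set.left_mem_uIcc
    have hw := (hg.neg.exp).mul (h2 hx').hasDerivAt
    have := hw.deriv
    refine (le_of_eq this).trans ?_
    have hh := mul_le_mul_of_nonneg_left (h1 hx) (Real.exp_pos (-∫ v in s..x, β v)).le
    simp only [Pi.neg_apply]
    nlinarith [hh]
  rw [h1] at h2
  simp at h2
  linarith

lemma deriv_abs_le {f : ℝ → ℝ} {x g A B c : ℝ} (hf : HasDerivAt f g x)
    (hd : DifferentiableAt ℝ (fun y => |f y|) x) (hg : g = A - c * f x) (hA : |A| ≤ B) :
    deriv (fun y => |f y|) x ≤ B - c * |f x| := by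
  have hA' := abs_le.mp hA
  rcases lt_trichotomy (f x) 0 with h | h | h
  · have he : (fun y => |f y|) =ᶠ[𝓝 x] fun y => - f y := by
      filter_upwards [hf.continuousAt.eventually_lt_const h] with y hy
      exact abs_of_neg hy
    rw [he.deriv_eq, hf.fun_neg.deriv, abs_of_neg h, hg]
    linarith
  · have : IsLocalMin (fun y => |f y|) x := by
      refine Eventually.of_forall fun y => ?_
      simp [h]
    rw [this.deriv_eq_zero, h]
    simp; linarith
  · have he : (fun y => |f y|) =ᶠ[𝓝 x] fun y => f y := by
      filter_upwards [hf.continuousAt.eventually_const_lt h] with y hy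
      exact abs_of_pos hy
    rw [he.deriv_eq, hf.deriv, abs_of_pos h, hg]
    linarith

lemma alg (e l m x : ℕ → ℝ) (b : ℝ) (N : ℕ) (hx0 : x 0 = 0) (hm0 : m 0 = 0) (hx : ∀ k, 0 ≤ x k)
    (hc : ∀ j < N, e (j+2) * l (j+1) - e (j+1) * (l j + m (j+1)) + e j * m j ≤ b * e (j+1)) :
    ∑ k ∈ Finset.range N, e (k+1) * (l k * x k + m (k+1) * x (k+2) - (l k + m (k+1)) * x (k+1))
      + e (N+1) * l N * x N ≤
    b * ∑ k ∈ Finset.range N, e (k+1) * x (k+1) + e N * m N * x (N+1) := by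
  induction N with
  | zero => simp [hx0, hm0]
  | succ n ih =>
    have h1 := ih fun j hj => hc j (by omega)
    have h2 := mul_le_mul_of_nonneg_right (hc n (by omega)) (hx (n+1))
    rw [Finset.sum_range_succ, Finset.sum_range_succ]
    nlinarith [h1, h2]

/-- The tail process and its system. -/
lemma coreA {lam mu S : ℕ → ℝ → ℝ} {s t : ℝ} (hst : s ≤ t)
    (hS0 : ∀ u, S 0 u = 0) (hmu0 : ∀ u, mu 0 u = 0)
    (hlam : ∀ n, ∀ u ∈ Set.Icc s t, 0 ≤ lam n u) (hmu : ∀ n, ∀ u ∈ Set.Icc s t, 0 ≤ mu n u)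
    (hint : ∀ k, IntervalIntegrable (fun u => lam k u * S k u + mu (k+1) u * S (k+2) u
      - (lam k u + mu (k+1) u) * S (k+1) u) volume s t)
    (hS : ∀ k, ∀ u ∈ Set.Icc s t, S (k+1) u = S (k+1) s + ∫ v in s..u,
      (lam k v * S k v + mu (k+1) v * S (k+2) v - (lam k v + mu (k+1) v) * S (k+1) v))
    {e : ℕ → ℝ} (he : ∀ k, 0 ≤ e (k+1)) (N : ℕ) {β R : ℝ → ℝ}
    (hβ : IntervalIntegrable β volume s t) (hR : IntervalIntegrable R volume s t)
    (hcol : ∀ᵐ u, u ∈ Set.Icc s t → ∀ j < N, e (j+2) * lam (j+1) u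
      - e (j+1) * (lam j u + mu (j+1) u) + e j * mu j u ≤ β u * e (j+1))
    (hRb : ∀ᵐ u, u ∈ Set.Icc s t → e N * mu N u * |S (N+1) u| ≤ R u) :
    Real.exp (-∫ u in s..t, β u) * ∑ k ∈ Finset.range N, e (k+1) * |S (k+1) t| ≤
      ∑ k ∈ Finset.range N, e (k+1) * |S (k+1) s|
        + ∫ u in s..t, Real.exp (-∫ v in s..u, β v) * R u := by
  -- replace S by its globally defined primitive
  let P : ℕ → ℝ → ℝ := fun k u => S (k+1) s + ∫ v in s..u,
      (lam k v * S k v + mu (k+1) v * S (k+2) v - (lam k v + mu (k+1) v) * S (k+1) v)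
  have hPac : ∀ k, AbsolutelyContinuousOnInterval (P k) s t := fun k => by
    have h1 := (hint k).absolutelyContinuousOnInterval_intervalIntegral (c := s) Set.left_mem_uIcc
    have h2 : AbsolutelyContinuousOnInterval (fun _ : ℝ => S (k+1) s) s t :=
      (contDiff_const.contDiffOn (n := 1)).absolutelyContinuousOnInterval
    exact h2.add h1
  have hPabs : ∀ k, AbsolutelyContinuousOnInterval (fun u => |P k u|) s t := fun k => ac_abs (hPac k)
  have hVac := ac_sum N fun k => (hPabs k).const_mul (e (k+1))
  have hPS : ∀ k, ∀ u ∈ Set.Icc s t, P k u = S (k+1) u := fun k u hu => (hS k u hu).symm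
  have key := gron hst hVac hβ hR ?_
  · simp only [hPS _ t (Set.right_mem_Icc.2 hst), hPS _ s (Set.left_mem_Icc.2 hst)] at key
    exact key
  · have hall : ∀ᵐ x, ∀ k, x ∈ Set.uIcc s t → DifferentiableAt ℝ (fun u => |P k u|) x :=
      ae_all_iff.2 fun k => (hPabs k).ae_differentiableAt
    have hall2 := ae_all_iff.2 fun k => (hint k).ae_hasDerivAt_integral
    filter_upwards [hall, hall2, hcol, hRb] with x h1 h2 h3 h4 hx
    have hx' : x ∈ Set.uIcc s t := by rwa [Set.uIcc_of_le hst]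
    have hder : ∀ k, deriv (fun u => |P k u|) x ≤ lam k x * |S k x| + mu (k+1) x * |S (k+2) x|
        - (lam k x + mu (k+1) x) * |S (k+1) x| := fun k => by
      have hg : HasDerivAt (P k) _ x := (h2 k hx' s Set.left_mem_uIcc).const_add (S (k+1) s)
      rw [← hPS k x hx]
      refine deriv_abs_le hg (h1 k hx') (A := lam k x * S k x + mu (k+1) x * S (k+2) x) ?_ ?_
      · rw [hPS k x hx]
      · refine (abs_add_le _ _).trans ?_
        rw [abs_mul, abs_mul, abs_of_nonneg (hlam k x hx), abs_of_nonneg (hmu (k+1) x hx)]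
    have hsum : deriv (fun u => ∑ k ∈ Finset.range N, e (k+1) * |P k u|) x =
        ∑ k ∈ Finset.range N, e (k+1) * deriv (fun u => |P k u|) x := by
      refine HasDerivAt.deriv ?_
      exact HasDerivAt.fun_sum fun k _ => (h1 k hx').hasDerivAt.const_mul (e (k+1))
    rw [hsum]
    have halg := alg e (fun k => lam k x) (fun k => mu k x) (fun k => |S k x|) (β x) N
      (by simp [hS0]) (hmu0 x) (fun k => abs_nonneg _) (h3 hx)
    have h5 : ∑ k ∈ Finset.range N, e (k+1) * deriv (fun u => |P k u|) x ≤
      ∑ k ∈ Finset.range N, e (k+1) * (lam k x * |S k x| + mu (k+1) x * |S (k+2) x|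
        - (lam k x + mu (k+1) x) * |S (k+1) x|) :=
      Finset.sum_le_sum fun k _ => mul_le_mul_of_nonneg_left (hder k) (he k)
    have h6 : 0 ≤ e (N+1) * lam N x * |S N x| :=
      mul_nonneg (mul_nonneg (he N) (hlam N x hx)) (abs_nonneg _)
    have h7 : ∀ k, |P k x| = |S (k+1) x| := fun k => by rw [hPS k x hx]
    simp only [h7]
    have := h4 hx
    linarith

lemma coreB1 {lam mu S : ℕ → ℝ → ℝ} {s t L : ℝ} (hst : s ≤ t) (hL0 : 0 ≤ L)
    (hS0 : ∀ u, S 0 u = 0) (hmu0 : ∀ u, mu 0 u = 0)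
    (hlam : ∀ n, ∀ u ∈ Set.Icc s t, 0 ≤ lam n u) (hmu : ∀ n, ∀ u ∈ Set.Icc s t, 0 ≤ mu n u)
    (hL : ∀ᵐ u, u ∈ Set.Icc s t → ∀ n, lam n u + mu n u ≤ L)
    (hS1 : ∀ k, ∀ u ∈ Set.Icc s t, |S k u| ≤ 1)
    (hint : ∀ k, IntervalIntegrable (fun u => lam k u * S k u + mu (k+1) u * S (k+2) u
      - (lam k u + mu (k+1) u) * S (k+1) u) volume s t)
    (hS : ∀ k, ∀ u ∈ Set.Icc s t, S (k+1) u = S (k+1) s + ∫ v in s..u,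
      (lam k v * S k v + mu (k+1) v * S (k+2) v - (lam k v + mu (k+1) v) * S (k+1) v))
    {d : ℕ → ℝ} (hdpos : ∀ k, 1 ≤ k → 0 < d k) (hdmono : ∀ k, 1 ≤ k → d k ≤ d (k + 1))
    {al : ℝ → ℝ} (hal : IntervalIntegrable al volume s t)
    (hcol : ∀ᵐ u, u ∈ Set.Icc s t → ∀ j, d (j+2) * lam (j+1) u
      - d (j+1) * (lam j u + mu (j+1) u) + d j * mu j u ≤ -al u * d (j+1))
    (hsum : Summable fun k => d (k+1) * |S (k+1) s|) (M : ℕ) :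
    ∑ k ∈ Finset.range (M+1), d (k+1) * |S (k+1) t| ≤
      Real.exp (∫ u in s..t, (|al u| + 3 * L)) * ∑' k, d (k+1) * |S (k+1) s| := by
  set e : ℕ → ℝ := fun k => d (min k (M+1)) * (1/2) ^ (k - (M+1)) with he
  have hle : ∀ k, k ≤ M+1 → e k = d k := fun k hk => by
    simp [he, min_eq_left hk, Nat.sub_eq_zero_of_le hk]
  have hgt : ∀ k, M+1 ≤ k → e (k+1) = e k / 2 := fun k hk => by
    simp only [he]
    rw [min_eq_right hk, min_eq_right (by omega), show k + 1 - (M+1) = (k - (M+1)) + 1 by omega,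
      pow_succ]
    ring
  have hepos : ∀ k, 0 < e (k+1) := fun k =>
    mul_pos (hdpos _ (by simp)) (by positivity)
  have heled : ∀ k, e (k+1) ≤ d (k+1) := by
    intro k
    induction k with
    | zero => rw [hle _ (by omega)]
    | succ n ih =>
      rcases le_or_gt (n+2) (M+1) with h | h
      · rw [hle _ h]
      · rw [hgt (n+1) (by omega)]
        have := hepos n
        have := hdmono (n+1) (by omega)
        linarith
  have hβ : IntervalIntegrable (fun u => |al u| + 3 * L) volume s t :=
    hal.abs.add intervalIntegrable_const
  have hN : ∀ n, Real.exp (-∫ u in s..t, (|al u| + 3 * L)) *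
      ∑ k ∈ Finset.range (M+1), d (k+1) * |S (k+1) t| ≤
      (∑' k, d (k+1) * |S (k+1) s|) + (t - s) * (d (M+1) * (1/2)^n * L) := by
    intro n
    have hεnn : 0 ≤ d (M+1) * (1/2)^n * L :=
      mul_nonneg (mul_nonneg (hdpos _ (by omega)).le (by positivity)) hL0
    have key := coreA (R := fun _ => d (M+1) * (1/2)^n * L) hst hS0 hmu0 hlam hmu hint hS
      (fun k => (hepos k).le)
      (M + 1 + n) hβ intervalIntegrable_const ?_ ?_
    · have h1 : ∑ k ∈ Finset.range (M+1), d (k+1) * |S (k+1) t| ≤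
          ∑ k ∈ Finset.range (M+1+n), e (k+1) * |S (k+1) t| := by
        calc _ = ∑ k ∈ Finset.range (M+1), e (k+1) * |S (k+1) t| :=
              Finset.sum_congr rfl fun k hk => by
                rw [hle (k+1) (by have := Finset.mem_range.1 hk; omega)]
          _ ≤ _ := Finset.sum_le_sum_of_subset_of_nonneg (by
              intro k hk; simp at *; omega) fun k _ _ => mul_nonneg (hepos k).le (abs_nonneg _)
      have h2 : ∑ k ∈ Finset.range (M+1+n), e (k+1) * |S (k+1) s| ≤
          ∑' k, d (k+1) * |S (k+1) s| := by
        calc _ ≤ ∑ k ∈ Finset.range (M+1+n), d (k+1) * |S (k+1) s| :=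
              Finset.sum_le_sum fun k _ => mul_le_mul_of_nonneg_right (heled k) (abs_nonneg _)
          _ ≤ _ := hsum.sum_le_tsum _ fun k _ => mul_nonneg (hdpos _ (by omega)).le (abs_nonneg _)
      have h3 : ∫ u in s..t, Real.exp (-∫ v in s..u, (|al v| + 3 * L)) * (d (M+1) * (1/2)^n * L)
          ≤ ∫ u in s..t, (d (M+1) * (1/2)^n * L) := by
        have hc : ContinuousOn (fun u => Real.exp (-∫ v in s..u, (|al v| + 3 * L)))
            (Set.uIcc s t) :=
          (continuousOn_primitive_interval' hβ Set.left_mem_uIcc).neg.rexp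
        refine integral_mono_on hst (intervalIntegrable_const.continuousOn_mul hc)
          intervalIntegrable_const fun u hu => ?_
        refine mul_le_of_le_one_left hεnn ?_
        rw [Real.exp_le_one_iff, neg_nonpos]
        exact integral_nonneg hu.1 fun v _ => by positivity
      simp only [intervalIntegral.integral_const, smul_eq_mul] at h3
      have h4 := mul_le_mul_of_nonneg_left h1 (Real.exp_pos (-∫ u in s..t, (|al u| + 3 * L))).le
      linarith
    · filter_upwards [hcol, hL] with u h1 h2 hu j _
      rcases le_or_gt (j+1) (M+1) with hj | hj
      · rw [hle _ hj, hle j (by omega)]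
        have h3 := h1 hu j
        have h4 := mul_le_mul_of_nonneg_right (heled (j+1)) (hlam (j+1) u hu)
        have h5 : -al u * d (j+1) ≤ (|al u| + 3 * L) * d (j+1) :=
          mul_le_mul_of_nonneg_right (by linarith [neg_le_abs (al u)]) (hdpos _ (by omega)).le
        linarith
      · have e1 := hgt (j+1) (by omega)
        have e2 := hgt j (by omega)
        have e3 : e j = 2 * e (j+1) := by linarith
        rw [e1, e3]
        have p := hepos j
        have a1 := h2 hu (j+1)
        have a2 := h2 hu j
        have a3 := hlam (j+1) u hu
        have a4 := hlam j u hu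
        have a5 := hmu (j+1) u hu
        have a6 := hmu j u hu
        have a7 := abs_nonneg (al u)
        have : lam (j+1) u / 2 - (lam j u + mu (j+1) u) + 2 * mu j u ≤ |al u| + 3 * L := by
          linarith
        have := mul_le_mul_of_nonneg_right this p.le
        linarith
    · filter_upwards [hL] with u h2 hu
      have e0 : e (M+1+n) = d (M+1) * (1/2)^n := by simp [he]
      rw [e0]
      have p : 0 ≤ d (M+1) * (1/2)^n := mul_nonneg (hdpos _ (by omega)).le (by positivity)
      have a1 := h2 hu (M+1+n)
      have a4 := hlam (M+1+n) u hu
      have a6 := hmu (M+1+n) u hu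
      calc d (M+1) * (1/2)^n * mu (M+1+n) u * |S (M+1+n+1) u|
          ≤ d (M+1) * (1/2)^n * mu (M+1+n) u * 1 :=
            mul_le_mul_of_nonneg_left (hS1 _ u hu) (mul_nonneg p a6)
        _ ≤ _ := by
            rw [mul_one]; exact mul_le_mul_of_nonneg_left (by linarith) p
  have hlim : Tendsto (fun n : ℕ => (∑' k, d (k+1) * |S (k+1) s|)
      + (t - s) * (d (M+1) * (1/2)^n * L)) atTop
      (𝓝 ((∑' k, d (k+1) * |S (k+1) s|) + (t - s) * (d (M+1) * 0 * L))) := by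
    refine Tendsto.const_add _ (Tendsto.const_mul _ (Tendsto.mul_const _ (Tendsto.const_mul _ ?_)))
    exact tendsto_pow_atTop_nhds_zero_of_lt_one (by norm_num) (by norm_num)
  have hfin := ge_of_tendsto' hlim hN
  simp only [mul_zero, zero_mul, add_zero] at hfin
  rw [Real.exp_neg] at hfin
  have := (inv_mul_le_iff₀ (Real.exp_pos _)).1 hfin
  exact this

lemma coreB2 {lam mu S : ℕ → ℝ → ℝ} {s t L : ℝ} (hst : s ≤ t) (hL0 : 0 ≤ L)
    (hS0 : ∀ u, S 0 u = 0) (hmu0 : ∀ u, mu 0 u = 0)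
    (hlam : ∀ n, ∀ u ∈ Set.Icc s t, 0 ≤ lam n u) (hmu : ∀ n, ∀ u ∈ Set.Icc s t, 0 ≤ mu n u)
    (hL : ∀ᵐ u, u ∈ Set.Icc s t → ∀ n, lam n u + mu n u ≤ L)
    (hS1 : ∀ k, ∀ u ∈ Set.Icc s t, |S k u| ≤ 1)
    (hint : ∀ k, IntervalIntegrable (fun u => lam k u * S k u + mu (k+1) u * S (k+2) u
      - (lam k u + mu (k+1) u) * S (k+1) u) volume s t)
    (hS : ∀ k, ∀ u ∈ Set.Icc s t, S (k+1) u = S (k+1) s + ∫ v in s..u,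
      (lam k v * S k v + mu (k+1) v * S (k+2) v - (lam k v + mu (k+1) v) * S (k+1) v))
    {d : ℕ → ℝ} (hdpos : ∀ k, 1 ≤ k → 0 < d k) (hdmono : ∀ k, 1 ≤ k → d k ≤ d (k + 1))
    {al : ℝ → ℝ} (hal : IntervalIntegrable al volume s t)
    (hcol : ∀ᵐ u, u ∈ Set.Icc s t → ∀ j, d (j+2) * lam (j+1) u
      - d (j+1) * (lam j u + mu (j+1) u) + d j * mu j u ≤ -al u * d (j+1))
    (hsum : Summable fun k => d (k+1) * |S (k+1) s|) :
    (Summable fun k => d (k+1) * |S (k+1) t|) ∧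
    ∑' k, d (k+1) * |S (k+1) t| ≤
      Real.exp (-∫ u in s..t, al u) * ∑' k, d (k+1) * |S (k+1) s| := by
  set D := ∑' k, d (k+1) * |S (k+1) s| with hD
  have hnn : ∀ u k, 0 ≤ d (k+1) * |S (k+1) u| := fun u k =>
    mul_nonneg (hdpos _ (by omega)).le (abs_nonneg _)
  have hβ : IntervalIntegrable (fun u => |al u| + 3 * L) volume s t :=
    hal.abs.add intervalIntegrable_const
  have hD0 : 0 ≤ D := tsum_nonneg (hnn s)
  set K := Real.exp (∫ u in s..t, (|al u| + 3 * L)) * D with hK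
  have hbd : ∀ u ∈ Set.Icc s t, ∀ n, ∑ k ∈ Finset.range n, d (k+1) * |S (k+1) u| ≤ K := by
    intro u hu n
    have hsub : Set.Icc s u ⊆ Set.Icc s t := Set.Icc_subset_Icc_right hu.2
    have hsub' : Set.uIcc s u ⊆ Set.uIcc s t := by
      rw [Set.uIcc_of_le hu.1, Set.uIcc_of_le hst]; exact hsub
    have h1 := coreB1 (t := u) hu.1 hL0 hS0 hmu0 (fun n v hv => hlam n v (hsub hv))
      (fun n v hv => hmu n v (hsub hv)) (hL.mono fun v h hv => h (hsub hv))
      (fun n v hv => hS1 n v (hsub hv)) (fun k => (hint k).mono_set hsub')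
      (fun n v hv => hS n v (hsub hv)) hdpos hdmono (hal.mono_set hsub')
      (hcol.mono fun v h hv => h (hsub hv)) hsum n
    have h2 : ∑ k ∈ Finset.range n, d (k+1) * |S (k+1) u| ≤
        ∑ k ∈ Finset.range (n+1), d (k+1) * |S (k+1) u| := by
      rw [Finset.sum_range_succ]; linarith [hnn u n]
    refine h2.trans (h1.trans ?_)
    refine mul_le_mul_of_nonneg_right (Real.exp_le_exp.2 ?_) hD0
    refine integral_mono_interval le_rfl hu.1 hu.2 ?_ hβ
    exact Eventually.of_forall fun v => by
      simp only [Pi.zero_apply]; positivity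
  have hsu : ∀ u ∈ Set.Icc s t, Summable fun k => d (k+1) * |S (k+1) u| := fun u hu =>
    summable_of_sum_range_le (hnn u) (hbd u hu)
  have ht : t ∈ Set.Icc s t := Set.right_mem_Icc.2 hst
  refine ⟨hsu t ht, ?_⟩
  have hScont : ∀ k, ContinuousOn (S (k+1)) (Set.uIcc s t) := fun k => by
    have h1 := continuousOn_primitive_interval' (hint k) Set.left_mem_uIcc
    refine ((continuousOn_const (c := S (k+1) s)).add h1).congr fun u hu => ?_
    rw [Set.uIcc_of_le hst] at hu
    exact hS k u hu
  have hec : ContinuousOn (fun u => Real.exp (-∫ v in s..u, -al v)) (Set.uIcc s t) :=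
    (continuousOn_primitive_interval' hal.neg Set.left_mem_uIcc).neg.rexp
  have hFc : ∀ n, ContinuousOn (fun u => Real.exp (-∫ v in s..u, -al v) *
      (L * (d (n+2) * |S (n+2) u|))) (Set.uIcc s t) := fun n =>
    hec.mul (continuousOn_const.mul (continuousOn_const.mul (hScont (n+1)).abs))
  have hlim : Tendsto (fun n : ℕ => ∫ u in s..t, Real.exp (-∫ v in s..u, -al v) *
      (L * (d (n+2) * |S (n+2) u|))) atTop (𝓝 (∫ u in s..t, (0:ℝ))) := by
    refine intervalIntegral.tendsto_integral_filter_of_dominated_convergence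
      (fun u => Real.exp (-∫ v in s..u, -al v) * (L * K)) ?_ ?_ ?_ ?_
    · exact Eventually.of_forall fun n =>
        ((hFc n).mono Set.uIoc_subset_uIcc).aestronglyMeasurable measurableSet_uIoc
    · refine Eventually.of_forall fun n => Eventually.of_forall fun u hu => ?_
      have hu' : u ∈ Set.Icc s t := by
        rw [← Set.uIcc_of_le hst]; exact Set.uIoc_subset_uIcc hu
      have hp : 0 ≤ d (n+2) * |S (n+2) u| := hnn u (n+1)
      rw [Real.norm_of_nonneg (by positivity)]
      have : d (n+2) * |S (n+2) u| ≤ K := by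
        have h1 := hbd u hu' (n+2)
        rw [Finset.sum_range_succ] at h1
        have h2 := Finset.sum_nonneg fun k (_ : k ∈ Finset.range (n+1)) => hnn u k
        simp only [add_assoc] at h1 h2
        norm_num at h1 h2
        linarith
      gcongr
    · exact (hec.mul continuousOn_const).intervalIntegrable
    · refine Eventually.of_forall fun u hu => ?_
      have hu' : u ∈ Set.Icc s t := by
        rw [← Set.uIcc_of_le hst]; exact Set.uIoc_subset_uIcc hu
      have h1 := (hsu u hu').tendsto_atTop_zero.comp (tendsto_add_atTop_nat 1)
      have h2 := (h1.const_mul L).const_mul (Real.exp (-∫ v in s..u, -al v))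
      simpa [Function.comp_def, add_assoc] using h2
  have hineq : ∀ n, Real.exp (-∫ u in s..t, -al u) *
      ∑ k ∈ Finset.range (n+1), d (k+1) * |S (k+1) t| ≤ D + ∫ u in s..t,
        Real.exp (-∫ v in s..u, -al v) * (L * (d (n+2) * |S (n+2) u|)) := by
    intro n
    have key := coreA (R := fun u => L * (d (n+2) * |S (n+2) u|)) hst hS0 hmu0 hlam hmu hint hS
      (fun k => (hdpos (k+1) (by omega)).le)
      (n+1) hal.neg
      (continuousOn_const.mul (continuousOn_const.mul (hScont (n+1)).abs)).intervalIntegrable ?_ ?_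
    · refine key.trans ?_
      have := hsum.sum_le_tsum (Finset.range (n+1)) fun k _ => hnn s k
      exact add_le_add this le_rfl
    · filter_upwards [hcol] with u h hu j _
      exact h hu j
    · filter_upwards [hL] with u h hu
      have a1 := h hu (n+1)
      have a2 := hlam (n+1) u hu
      have a3 := hmu (n+1) u hu
      have a4 := hdmono (n+1) (by omega)
      have a5 := hdpos (n+1) (by omega)
      calc d (n+1) * mu (n+1) u * |S (n+1+1) u| ≤ d (n+2) * L * |S (n+2) u| := by
            refine mul_le_mul_of_nonneg_right ?_ (abs_nonneg _)
            exact mul_le_mul a4 (by linarith) a3 (by linarith)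
        _ = _ := by ring
  have hl2 := (((hsu t ht).hasSum.tendsto_sum_nat.comp (tendsto_add_atTop_nat 1)).const_mul
    (Real.exp (-∫ u in s..t, -al u)))
  have hfin := le_of_tendsto_of_tendsto' hl2 (hlim.const_add D) hineq
  simp only [intervalIntegral.integral_zero, add_zero, intervalIntegral.integral_neg, neg_neg]
    at hfin
  rw [Real.exp_neg, le_inv_mul_iff₀ (Real.exp_pos _)]
  exact hfin

lemma meas_primitive (f : ℝ → ℝ) :
    AEStronglyMeasurable (fun t => ∫ u in (0:ℝ)..t, f u) (volume.restrict (Set.Ici 0)) := by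
  set A : Set ℝ := {t | 0 ≤ t ∧ IntervalIntegrable f volume 0 t} with hA
  have hdown : ∀ t ∈ A, ∀ u, 0 ≤ u → u ≤ t → u ∈ A := fun t ht u hu hut =>
    ⟨hu, ht.2.mono_set (by rw [Set.uIcc_of_le hu, Set.uIcc_of_le ht.1]; exact Set.Icc_subset_Icc_right hut)⟩
  have hAm : MeasurableSet A := by
    refine Set.OrdConnected.measurableSet ⟨fun x hx y hy z hz => ?_⟩
    exact hdown y hy z (hx.1.trans hz.1) hz.2
  have hcont : ContinuousOn (fun t => ∫ u in (0:ℝ)..t, f u) A := by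
    intro t ht
    by_cases h : ∃ t' ∈ A, t < t'
    · obtain ⟨t', ht', htt'⟩ := h
      have h1 := continuousOn_primitive_interval' ht'.2 Set.left_mem_uIcc
      rw [Set.uIcc_of_le ht'.1] at h1
      refine (h1 t ⟨ht.1, htt'.le⟩).mono_of_mem_nhdsWithin ?_
      filter_upwards [self_mem_nhdsWithin, nhdsWithin_le_nhds (Iio_mem_nhds htt')] with x hx hx'
      exact ⟨hx.1, le_of_lt hx'⟩
    · push Not at h
      have h1 := continuousOn_primitive_interval' ht.2 Set.left_mem_uIcc
      rw [Set.uIcc_of_le ht.1] at h1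
      exact (h1 t ⟨ht.1, le_rfl⟩).mono fun x hx => ⟨hx.1, h x hx⟩
  have h1 : AEStronglyMeasurable (fun t => ∫ u in (0:ℝ)..t, f u) (volume.restrict A) :=
    hcont.aestronglyMeasurable hAm
  have h2 : AEStronglyMeasurable (fun t => ∫ u in (0:ℝ)..t, f u)
      (volume.restrict (Set.Ici 0 \ A)) := by
    refine (aestronglyMeasurable_const (b := (0:ℝ))).congr ?_
    rw [EventuallyEq, ae_restrict_iff' (measurableSet_Ici.diff hAm)]
    refine Eventually.of_forall fun t ht => ?_
    symm
    exact integral_undef fun h => ht.2 ⟨ht.1, h⟩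
  have h3 : Set.Ici (0:ℝ) = A ∪ (Set.Ici 0 \ A) := by
    rw [Set.union_sdiff_cancel]; exact fun t ht => ht.1
  rw [h3]
  exact aestronglyMeasurable_union_iff.2 ⟨h1, h2⟩

lemma bd_row0 (lam mu : ℕ → ℝ → ℝ) (q : ℕ → ℝ) (u : ℝ) (h0 : mu 0 u = 0) :
    ∑' j, bdMatrix lam mu 0 j u * q j = mu 1 u * q 1 - lam 0 u * q 0 := by
  rw [tsum_eq_sum (s := Finset.range 2)]
  · simp [Finset.sum_range_succ, bdMatrix, h0]; ring
  · intro j hj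
    have : 2 ≤ j := by simp at hj; omega
    have h : bdMatrix lam mu 0 j u = 0 := by
      unfold bdMatrix
      rw [if_neg (by omega), if_neg (by omega), if_neg (by omega)]
    rw [h, zero_mul]

lemma bd_row (lam mu : ℕ → ℝ → ℝ) (q : ℕ → ℝ) (u : ℝ) (i : ℕ) :
    ∑' j, bdMatrix lam mu (i+1) j u * q j =
      (mu (i+2) u * q (i+2) - lam (i+1) u * q (i+1)) - (mu (i+1) u * q (i+1) - lam i u * q i) := by
  have hz : ∀ j, j ≠ i → j ≠ i+1 → j ≠ i+2 → bdMatrix lam mu (i+1) j u = 0 := by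
    intro j h1 h2 h3
    unfold bdMatrix
    rw [if_neg (by omega), if_neg (by omega), if_neg (by omega)]
  rw [tsum_eq_sum (s := {i, i+1, i+2})]
  · rw [Finset.sum_insert (by simp), Finset.sum_insert (by simp), Finset.sum_singleton]
    have e1 : bdMatrix lam mu (i+1) i u = lam i u := by simp [bdMatrix]
    have e2 : bdMatrix lam mu (i+1) (i+1) u = -(lam (i+1) u + mu (i+1) u) := by simp [bdMatrix]
    have e3 : bdMatrix lam mu (i+1) (i+2) u = mu (i+2) u := by simp [bdMatrix]
    rw [e1, e2, e3]; ring
  · intro j hj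
    simp only [Finset.mem_insert, Finset.mem_singleton, not_or] at hj
    rw [hz j hj.1 hj.2.1 hj.2.2, zero_mul]

lemma bd_term_int {lam : ℝ → ℝ} (hl : LocallyIntegrableOn lam (Set.Ici 0)) {q : ℝ → ℝ}
    (hq : AEStronglyMeasurable q (volume.restrict (Set.Ici 0))) (hq1 : ∀ u, 0 ≤ u → |q u| ≤ 1)
    {s t : ℝ} (hs : 0 ≤ s) (hst : s ≤ t) :
    IntervalIntegrable (fun u => lam u * q u) volume s t := by
  have hsub : Set.Icc s t ⊆ Set.Ici 0 := fun u hu => hs.trans hu.1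
  have h1 : IntegrableOn lam (Set.Icc s t) :=
    hl.integrableOn_compact_subset hsub isCompact_Icc
  rw [intervalIntegrable_iff_integrableOn_Icc_of_le hst]
  refine Integrable.mul_bdd (c := 1) h1 (hq.mono_measure (Measure.restrict_mono hsub le_rfl)) ?_
  rw [ae_restrict_iff' measurableSet_Icc]
  exact Eventually.of_forall fun u hu => hq1 u (hsub hu)

lemma sol_facts {lam mu : ℕ → ℝ → ℝ} (hmu0 : ∀ t : ℝ, mu 0 t = 0)
    (hlamloc : ∀ n, LocallyIntegrableOn (lam n) (Set.Ici 0))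
    (hmuloc : ∀ n, LocallyIntegrableOn (mu n) (Set.Ici 0))
    {p : ℝ → ℕ → ℝ} (hp : IsKolmogorovSolution (bdMatrix lam mu) p) :
    (∀ k, ∀ s t : ℝ, 0 ≤ s → s ≤ t →
      IntervalIntegrable (fun u => lam k u * p u k) volume s t ∧
      IntervalIntegrable (fun u => mu k u * p u k) volume s t) ∧
    (∀ k, ∀ s t : ℝ, 0 ≤ s → s ≤ t → ∑ i ∈ Finset.range (k+1), p t i =
      ∑ i ∈ Finset.range (k+1), p s i + ∫ u in s..t, (mu (k+1) u * p u (k+1) - lam k u * p u k)) := by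
  have hm : ∀ i, AEStronglyMeasurable (fun t => p t i) (volume.restrict (Set.Ici 0)) := by
    intro i
    have h1 := (aestronglyMeasurable_const (b := p 0 i)
      (μ := volume.restrict (Set.Ici (0:ℝ)))).add
      (meas_primitive fun u => ∑' j, bdMatrix lam mu i j u * p u j)
    refine h1.congr ?_
    rw [EventuallyEq, ae_restrict_iff' measurableSet_Ici]
    exact Eventually.of_forall fun t ht => (hp.2 i 0 t le_rfl ht).symm
  have h1 : ∀ i, ∀ u, 0 ≤ u → |p u i| ≤ 1 := fun i u hu => by
    obtain ⟨h1, h2⟩ := hp.1 u hu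
    rw [abs_of_nonneg (h1 i)]
    exact le_hasSum h2 i fun j _ => h1 j
  have hint : ∀ k, ∀ s t : ℝ, 0 ≤ s → s ≤ t →
      IntervalIntegrable (fun u => lam k u * p u k) volume s t ∧
      IntervalIntegrable (fun u => mu k u * p u k) volume s t := fun k s t hs hst =>
    ⟨bd_term_int (hlamloc k) (hm k) (h1 k) hs hst, bd_term_int (hmuloc k) (hm k) (h1 k) hs hst⟩
  refine ⟨hint, fun k s t hs hst => ?_⟩
  have hg : ∀ k, IntervalIntegrable (fun u => mu (k+1) u * p u (k+1) - lam k u * p u k)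
      volume s t := fun k => (hint (k+1) s t hs hst).2.sub (hint k s t hs hst).1
  induction k with
  | zero =>
    simp only [zero_add, Finset.sum_range_one]
    rw [hp.2 0 s t hs hst]
    simp only [bd_row0 lam mu _ _ (hmu0 _)]
  | succ n ih =>
    rw [Finset.sum_range_succ, ih, Finset.sum_range_succ _ (n+1), hp.2 (n+1) s t hs hst]
    simp only [bd_row]
    rw [intervalIntegral.integral_sub (hg (n+1)) (hg n)]
    ring

/-- ergodicity bound for the inhomogeneous birth–death queue, class I.
For any two solutions `p*`, `p**` of the forward Kolmogorov system of the birth–death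
process and any `0 ≤ s ≤ t` with `‖z*(s) − z**(s)‖_{1D} < ∞`,
`‖p*(t) − p**(t)‖ ≤ 4·exp(−∫_s^t α(u) du)·‖z*(s) − z**(s)‖_{1D}`; consequently, if
`∫_0^∞ α(t) dt = +∞` then `‖p*(t) − p**(t)‖ → 0` as `t → ∞` (weak ergodicity). -/
theorem classI_ergodicity_bound
    (lam mu : ℕ → ℝ → ℝ) (L : ℝ)
    (hlampos : ∀ n, ∀ t : ℝ, 0 ≤ t → 0 ≤ lam n t)
    (hmupos : ∀ n, ∀ t : ℝ, 0 ≤ t → 0 ≤ mu n t)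
    (hmu0 : ∀ t : ℝ, mu 0 t = 0)
    (hlamloc : ∀ n, LocallyIntegrableOn (lam n) (Set.Ici 0))
    (hmuloc : ∀ n, LocallyIntegrableOn (mu n) (Set.Ici 0))
    (hL : ∀ᵐ t : ℝ, 0 ≤ t → ∀ n, lam n t + mu n t ≤ L)
    (d : ℕ → ℝ) (hd1 : d 1 = 1) (hdpos : ∀ k, 1 ≤ k → 0 < d k)
    (hdmono : ∀ k, 1 ≤ k → d k ≤ d (k + 1))
    (hαfin : ∀ᵐ t : ℝ, 0 ≤ t → BddBelow (Set.range fun j : ℕ =>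
      mu (j + 1) t + lam j t - (d j / d (j + 1)) * mu j t
        - (d (j + 2) / d (j + 1)) * lam (j + 1) t))
    (hαloc : LocallyIntegrableOn (alphaBD d lam mu) (Set.Ici 0))
    (p₁ p₂ : ℝ → ℕ → ℝ)
    (hp₁ : IsKolmogorovSolution (bdMatrix lam mu) p₁)
    (hp₂ : IsKolmogorovSolution (bdMatrix lam mu) p₂)
    (hfin0 : Norm1DFinite d (fun k => p₁ 0 k - p₂ 0 k)) :
    (∀ s t : ℝ, 0 ≤ s → s ≤ t →
      Norm1DFinite d (fun k => p₁ s k - p₂ s k) →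
      (∑' k : ℕ, |p₁ t k - p₂ t k|) ≤
        4 * Real.exp (-∫ u in s..t, alphaBD d lam mu u) *
          norm1D d (fun k => p₁ s k - p₂ s k)) ∧
    (Tendsto (fun T : ℝ => ∫ u in (0 : ℝ)..T, alphaBD d lam mu u) atTop atTop →
      Tendsto (fun t : ℝ => ∑' k : ℕ, |p₁ t k - p₂ t k|) atTop (𝓝 0)) := by

  have hbound : ∀ s t : ℝ, 0 ≤ s → s ≤ t →
      Norm1DFinite d (fun k => p₁ s k - p₂ s k) →
      (∑' k : ℕ, |p₁ t k - p₂ t k|) ≤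
        4 * Real.exp (-∫ u in s..t, alphaBD d lam mu u) *
          norm1D d (fun k => p₁ s k - p₂ s k) := by
    intro s t hs hst hfin
    have hL0 : 0 ≤ L := by
      have h1 : ∀ᵐ u : ℝ ∂(volume.restrict (Set.Icc (0:ℝ) 1)), 0 ≤ L := by
        rw [ae_restrict_iff' measurableSet_Icc]
        filter_upwards [hL] with u hu hu'
        have := hu hu'.1 0
        linarith [hlampos 0 u hu'.1, hmupos 0 u hu'.1]
      have : (ae (volume.restrict (Set.Icc (0:ℝ) 1))).NeBot := by
        rw [ae_neBot]; simp [Measure.restrict_eq_zero]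
      exact h1.exists.choose_spec
    have hsub : Set.Icc s t ⊆ Set.Ici 0 := fun u hu => hs.trans hu.1
    obtain ⟨hi1, hk1⟩ := sol_facts hmu0 hlamloc hmuloc hp₁
    obtain ⟨hi2, hk2⟩ := sol_facts hmu0 hlamloc hmuloc hp₂
    set S : ℕ → ℝ → ℝ := fun k u => ∑ i ∈ Finset.range k, p₂ u i - ∑ i ∈ Finset.range k, p₁ u i
      with hSdef
    have hSS : ∀ k u, S k u - S (k+1) u = p₁ u k - p₂ u k := fun k u => by
      simp only [hSdef, Finset.sum_range_succ]; ring
    have hg : ∀ k u, lam k u * S k u + mu (k+1) u * S (k+2) u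
        - (lam k u + mu (k+1) u) * S (k+1) u =
        (mu (k+1) u * p₂ u (k+1) - lam k u * p₂ u k)
          - (mu (k+1) u * p₁ u (k+1) - lam k u * p₁ u k) := fun k u => by
      have a := hSS k u
      have b := hSS (k+1) u
      linear_combination lam k u * a - mu (k+1) u * b
    have hint1 : ∀ k, ∀ u ∈ Set.Icc s t, IntervalIntegrable
        (fun u => mu (k+1) u * p₁ u (k+1) - lam k u * p₁ u k) volume s u := fun k u hu =>
      (hi1 (k+1) s u hs hu.1).2.sub (hi1 k s u hs hu.1).1
    have hint2 : ∀ k, ∀ u ∈ Set.Icc s t, IntervalIntegrable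
        (fun u => mu (k+1) u * p₂ u (k+1) - lam k u * p₂ u k) volume s u := fun k u hu =>
      (hi2 (k+1) s u hs hu.1).2.sub (hi2 k s u hs hu.1).1
    have ht : t ∈ Set.Icc s t := Set.right_mem_Icc.2 hst
    have hpart : ∀ p : ℝ → ℕ → ℝ, IsKolmogorovSolution (bdMatrix lam mu) p → ∀ u, 0 ≤ u → ∀ k,
        0 ≤ ∑ i ∈ Finset.range k, p u i ∧ ∑ i ∈ Finset.range k, p u i ≤ 1 := by
      intro p hp u hu k
      obtain ⟨h1, h2⟩ := hp.1 u hu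
      exact ⟨Finset.sum_nonneg fun i _ => h1 i, sum_le_hasSum _ (fun i _ => h1 i) h2⟩
    have htail : ∀ u, 0 ≤ u → ∀ k, ∑' i, (p₁ u (k+1+i) - p₂ u (k+1+i)) = S (k+1) u := by
      intro u hu k
      have h1 := (hp₁.1 u hu).2
      have h2 := (hp₂.1 u hu).2
      have h3 := h1.sub h2
      have h4 := h3.summable.sum_add_tsum_nat_add (k+1)
      rw [h3.tsum_eq, Finset.sum_sub_distrib] at h4
      have h5 : ∑' i, (p₁ u (k+1+i) - p₂ u (k+1+i)) = ∑' i, (p₁ u (i+(k+1)) - p₂ u (i+(k+1))) :=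
        tsum_congr fun i => by rw [add_comm]
      rw [h5]
      simp only [hSdef]
      linarith
    have hα : IntervalIntegrable (alphaBD d lam mu) volume s t := by
      rw [intervalIntegrable_iff_integrableOn_Icc_of_le hst]
      exact hαloc.integrableOn_compact_subset hsub isCompact_Icc
    have hcol : ∀ᵐ u, u ∈ Set.Icc s t → ∀ j, d (j+2) * lam (j+1) u
        - d (j+1) * (lam j u + mu (j+1) u) + d j * mu j u ≤ -alphaBD d lam mu u * d (j+1) := by
      filter_upwards [hαfin] with u hu hu' j
      have h1 : alphaBD d lam mu u ≤ _ := ciInf_le (hu (hsub hu')) j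
      have hdj := hdpos (j+1) (by omega)
      have h2 := mul_le_mul_of_nonneg_right h1 hdj.le
      have h3 : (mu (j + 1) u + lam j u - d j / d (j + 1) * mu j u
          - d (j + 2) / d (j + 1) * lam (j + 1) u) * d (j+1) =
          d (j+1) * (lam j u + mu (j+1) u) - d j * mu j u - d (j+2) * lam (j+1) u := by
        field_simp
        ring
      rw [h3] at h2
      linarith
    have hsum : Summable fun k => d (k+1) * |S (k+1) s| := by
      have := hfin
      unfold Norm1DFinite at this
      simpa only [htail s hs] using this
    have hn : norm1D d (fun k => p₁ s k - p₂ s k) = ∑' k, d (k+1) * |S (k+1) s| := by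
      unfold norm1D
      simp only [htail s hs]
    obtain ⟨hsumt, hle⟩ := coreB2 (S := S) (lam := lam) (mu := mu) (L := L) hst hL0
      (fun u => by simp [hSdef]) hmu0
      (fun n u hu => hlampos n u (hsub hu)) (fun n u hu => hmupos n u (hsub hu))
      (hL.mono fun u h hu => h (hsub hu))
      (fun k u hu => by
        have h1 := hpart p₁ hp₁ u (hsub hu) k
        have h2 := hpart p₂ hp₂ u (hsub hu) k
        simp only [hSdef]
        rw [abs_le]; constructor <;> linarith [h1.1, h1.2, h2.1, h2.2])
      (fun k => by
        simp only [hg]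
        exact (hint2 k t ht).sub (hint1 k t ht))
      (fun k u hu => by
        simp only [hg]
        rw [intervalIntegral.integral_sub (hint2 k u hu) (hint1 k u hu)]
        simp only [hSdef]
        rw [hk1 k s u hs hu.1, hk2 k s u hs hu.1]
        ring)
      hdpos hdmono hα hcol hsum
    rw [hn]
    set D := ∑' k, d (k+1) * |S (k+1) s|
    have hd1' : ∀ k, 1 ≤ d (k+1) := by
      intro k
      induction k with
      | zero => simp [hd1]
      | succ n ih => exact ih.trans (hdmono (n+1) (by omega))
    have hle1 : ∀ k, |S (k+1) t| ≤ d (k+1) * |S (k+1) t| := fun k =>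
      le_mul_of_one_le_left (abs_nonneg _) (hd1' k)
    have hA : Summable fun k => |S (k+1) t| :=
      Summable.of_nonneg_of_le (fun k => abs_nonneg _) hle1 hsumt
    have hA0 : Summable fun k => |S k t| := (summable_nat_add_iff (f := fun k => |S k t|) 1).1 hA
    have hA0' : ∑' k, |S k t| = ∑' k, |S (k+1) t| := by
      rw [hA0.tsum_eq_zero_add]; simp [hSdef]
    have hwle : ∀ k, |p₁ t k - p₂ t k| ≤ |S k t| + |S (k+1) t| := fun k => by
      rw [← hSS]; exact abs_sub _ _
    have hw : Summable fun k => |p₁ t k - p₂ t k| :=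
      Summable.of_nonneg_of_le (fun k => abs_nonneg _) hwle (hA0.add hA)
    have f1 := hw.tsum_le_tsum hwle (hA0.add hA)
    rw [hA0.tsum_add hA, hA0'] at f1
    have f2 := hA.tsum_le_tsum hle1 hsumt
    have f3 : 0 ≤ Real.exp (-∫ u in s..t, alphaBD d lam mu u) * D :=
      mul_nonneg (Real.exp_pos _).le (tsum_nonneg fun k =>
        mul_nonneg (hdpos _ (by omega)).le (abs_nonneg _))
    linarith
  refine ⟨hbound, fun hT => ?_⟩
  refine squeeze_zero' (Eventually.of_forall fun t => tsum_nonneg fun k => abs_nonneg _)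
    ((eventually_ge_atTop 0).mono fun t ht => hbound 0 t le_rfl ht hfin0) ?_
  have h1 : Tendsto (fun t : ℝ => Real.exp (-∫ u in (0:ℝ)..t, alphaBD d lam mu u)) atTop (𝓝 0) :=
    Real.tendsto_exp_neg_atTop_nhds_zero.comp hT
  simpa using (h1.const_mul 4).mul_const (norm1D d (fun k => p₁ 0 k - p₂ 0 k))
end
end
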